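/- Let q₀ = −e^{−π√15/3}, which is the value of e^{2πiτ} at the CM point τ = 1/2 + i√15/6. Then t₃(q₀) = 1/64 and f₃(q₀) = 4√3 · Ω₁₅²; that is, the modular function −64(η(2τ)η(6τ)/(η(τ)η(3τ)))⁶ takes the value 1 at τ, and the weight-2 eta quotient (η(τ)η(3τ))⁴/(η(2τ)η(6τ))² equals 4√3 Ω₁₅². -/

import Mathlib

open scoped Real

/-- The `q`-expansion of the eta quotient `t = −(η(2z)η(6z)/(η(z)η(3z)))⁶` (real form). -/
noncomputable def t3 (q : ℝ) : ℝ :=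
  -q * ∏' n : ℕ, (((1 - q^(2*(n+1))) * (1 - q^(6*(n+1))))^6
      / ((1 - q^(n+1)) * (1 - q^(3*(n+1))))^6)

/-- The `q`-expansion of the eta quotient `f = (η(z)η(3z))⁴/(η(2z)η(6z))²` (real form). -/
noncomputable def f3 (q : ℝ) : ℝ :=
  ∏' n : ℕ, (((1 - q^(n+1)) * (1 - q^(3*(n+1))))^4
      / ((1 - q^(2*(n+1))) * (1 - q^(6*(n+1))))^2)

/-- The Chowla–Selberg period of `ℚ(√−15)`:
`Ω₁₅ = (30π)^{-1/2} (∏_{j=1}^{14} Γ(j/15)^{(−15/j)})^{1/4}`. -/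
noncomputable def Omega15 : ℝ :=
  (1 / Real.sqrt (30 * π)) *
    ((Real.Gamma (1/15) * Real.Gamma (2/15) * Real.Gamma (4/15) * Real.Gamma (8/15)) /
      (Real.Gamma (7/15) * Real.Gamma (11/15) * Real.Gamma (13/15) * Real.Gamma (14/15)))
      ^ ((1:ℝ)/4)

/-- Integer points on the ellipse `a x² + b y² = 4 n`. -/
def ellipsePoints (a b n : ℤ) : Set (ℤ × ℤ) := {w | a * w.1 ^ 2 + b * w.2 ^ 2 = 4 * n}

theorem ellipsePoints_finite {a b : ℤ} (ha : 0 < a) (hb : 0 < b) (n : ℤ) :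
    (ellipsePoints a b n).Finite := by
  refine ((Set.finite_Icc (-(4 * n)) (4 * n)).prod (Set.finite_Icc (-(4 * n)) (4 * n))).subset ?_
  rintro ⟨x, y⟩ h
  have h : a * x ^ 2 + b * y ^ 2 = 4 * n := h
  have hx : |x| ≤ x ^ 2 := by rw [← sq_abs]; nlinarith [abs_nonneg x, Int.le_self_sq |x|]
  have hy : |y| ≤ y ^ 2 := by rw [← sq_abs]; nlinarith [abs_nonneg y, Int.le_self_sq |y|]
  have h1 : x ^ 2 ≤ 4 * n := by nlinarith [sq_nonneg x, sq_nonneg y]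
  have h2 : y ^ 2 ≤ 4 * n := by nlinarith [sq_nonneg x, sq_nonneg y]
  exact ⟨Set.mem_Icc.2 (abs_le.1 (hx.trans h1)), Set.mem_Icc.2 (abs_le.1 (hy.trans h2))⟩

/-- The two reduced forms `x² + x y + 4 y²` and `2 x² + x y + 2 y²` of discriminant `-15`
are the only forms of this discriminant up to substitution. -/
theorem exists_reduction_disc_neg_fifteen (a : ℕ) (b c : ℤ) (ha : 0 < a)
    (h : b ^ 2 + 15 = 4 * a * c) :
    ∃ p q r s : ℤ,
      (∀ x y : ℤ, 4 * (a * x ^ 2 + b * x * y + c * y ^ 2) =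
        (p * x + q * y) ^ 2 + 15 * (r * x + s * y) ^ 2) ∨
      (∀ x y : ℤ, 4 * (a * x ^ 2 + b * x * y + c * y ^ 2) =
        5 * (p * x + q * y) ^ 2 + 3 * (r * x + s * y) ^ 2) := by
  induction a using Nat.strong_induction_on generalizing b c with
  | _ a ih =>
  have ha' : (0 : ℤ) < a := by exact_mod_cast ha
  -- translate so that `|b| ≤ a`
  obtain ⟨k, hk1, hk2⟩ : ∃ k : ℤ, -a ≤ b + 2 * a * k ∧ b + 2 * a * k ≤ a := by
    refine ⟨-((b + a) / (2 * a)), ?_, ?_⟩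
    · have := Int.mul_ediv_self_le (x := b + a) (k := 2 * a) (by positivity)
      linarith
    · have := Int.lt_mul_ediv_self_add (x := b + a) (k := 2 * a) (by positivity)
      linarith
  set b' := b + 2 * a * k with hb'
  set c' := c + b * k + a * k ^ 2 with hc'
  have h' : b' ^ 2 + 15 = 4 * a * c' := by rw [hb', hc']; linear_combination h
  have hc0 : 0 < c' := by
    by_contra! hcon
    nlinarith [sq_nonneg b']
  suffices H : ∃ p q r s : ℤ,
      (∀ x y : ℤ, 4 * (a * x ^ 2 + b' * x * y + c' * y ^ 2) =
        (p * x + q * y) ^ 2 + 15 * (r * x + s * y) ^ 2) ∨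
      (∀ x y : ℤ, 4 * (a * x ^ 2 + b' * x * y + c' * y ^ 2) =
        5 * (p * x + q * y) ^ 2 + 3 * (r * x + s * y) ^ 2) by
    obtain ⟨p, q, r, s, H⟩ := H
    refine ⟨p, q - p * k, r, s - r * k, H.imp (fun H x y ↦ ?_) (fun H x y ↦ ?_)⟩
    · have := H (x - k * y) y
      rw [hb', hc'] at this
      linear_combination this
    · have := H (x - k * y) y
      rw [hb', hc'] at this
      linear_combination this
  rcases lt_or_ge c' a with hlt | hge
  · obtain ⟨C, hC⟩ := Int.eq_ofNat_of_zero_le hc0.le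
    obtain ⟨p, q, r, s, H⟩ := ih C (by omega) (-b') a (by omega) (by rw [← hC]; linarith)
    refine ⟨-q, p, -s, r, H.imp (fun H x y ↦ ?_) (fun H x y ↦ ?_)⟩
    · have := H y (-x)
      rw [← hC] at this
      linear_combination this
    · have := H y (-x)
      rw [← hC] at this
      linear_combination this
  · have ha2 : (a : ℤ) ≤ 2 := by
      by_contra! hcon
      nlinarith
    have : a = 1 ∨ a = 2 := by omega
    rcases this with rfl | rfl
    · have hb1 : b' = -1 ∨ b' = 0 ∨ b' = 1 := by push_cast at hk1 hk2; omega
      rcases hb1 with hb | hb | hb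
      · have hcc : c' = 4 := by rw [hb] at h'; push_cast at h'; omega
        refine ⟨2, -1, 0, 1, Or.inl fun x y ↦ ?_⟩
        rw [hb, hcc]; push_cast; ring
      · rw [hb] at h'; push_cast at h'; omega
      · have hcc : c' = 4 := by rw [hb] at h'; push_cast at h'; omega
        refine ⟨2, 1, 0, 1, Or.inl fun x y ↦ ?_⟩
        rw [hb, hcc]; push_cast; ring
    · have hb1 : b' = -2 ∨ b' = -1 ∨ b' = 0 ∨ b' = 1 ∨ b' = 2 := by
        push_cast at hk1 hk2; omega
      rcases hb1 with hb | hb | hb | hb | hb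
      · rw [hb] at h'; push_cast at h'; omega
      · have hcc : c' = 2 := by rw [hb] at h'; push_cast at h'; omega
        refine ⟨1, -1, 1, 1, Or.inr fun x y ↦ ?_⟩
        rw [hb, hcc]; push_cast; ring
      · rw [hb] at h'; push_cast at h'; omega
      · have hcc : c' = 2 := by rw [hb] at h'; push_cast at h'; omega
        refine ⟨1, 1, 1, -1, Or.inr fun x y ↦ ?_⟩
        rw [hb, hcc]; push_cast; ring
      · rw [hb] at h'; push_cast at h'; omega

/-- The Kronecker symbol `(-15 / ·)`, as an integer-valued multiplicative character mod `15`. -/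
def chiInt : MulChar (ZMod 15) ℤ where
  toFun a := if a ∈ ({1, 2, 4, 8} : Finset (ZMod 15)) then 1
    else if a ∈ ({7, 11, 13, 14} : Finset (ZMod 15)) then -1 else 0
  map_one' := by decide
  map_mul' := by decide
  map_nonunit' := by decide

theorem chiInt_prime_eq_legendreSym (p : ℕ) [Fact p.Prime] (hp2 : p ≠ 2) (hp3 : p ≠ 3)
    (hp5 : p ≠ 5) : chiInt (p : ZMod 15) = legendreSym p (-15) := by
  have hp : p.Prime := Fact.out
  have hodd : Odd p := hp.odd_of_ne_two hp2
  rw [jacobiSym.legendreSym.to_jacobiSym, jacobiSym.mod_right _ hodd]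
  have h3 : ¬ 3 ∣ p := fun h ↦ hp3 ((Nat.prime_dvd_prime_iff_eq Nat.prime_three hp).1 h).symm
  have h5 : ¬ 5 ∣ p := fun h ↦ hp5 ((Nat.prime_dvd_prime_iff_eq Nat.prime_five hp).1 h).symm
  have hcast : (p : ZMod 15) = ((p % 60 : ℕ) : ZMod 15) := by
    rw [ZMod.natCast_eq_natCast_iff]
    exact ((Nat.mod_modEq p 60).of_dvd (by norm_num : 15 ∣ 60)).symm
  rw [hcast]
  have e60 : 4 * (-15 : ℤ).natAbs = 60 := by decide
  rw [e60]
  have hlt : p % 60 < 60 := Nat.mod_lt _ (by norm_num)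
  have h2' : p % 60 % 2 = 1 := by have := Nat.odd_iff.1 hodd; omega
  have h3' : p % 60 % 3 ≠ 0 := by omega
  have h5' : p % 60 % 5 ≠ 0 := by omega
  generalize p % 60 = m at *
  interval_cases m <;> first | omega | (norm_num <;> decide)

theorem exists_ellipse_point_of_split (p : ℕ) (hp : p.Prime) (hp3 : p ≠ 3) (hp5 : p ≠ 5)
    (hchi : chiInt (p : ZMod 15) = 1) :
    ∃ u v : ℤ, u ^ 2 + 15 * v ^ 2 = 4 * p ∨ 5 * u ^ 2 + 3 * v ^ 2 = 4 * p := by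
  have : Fact p.Prime := ⟨hp⟩
  obtain ⟨b, c, h⟩ : ∃ b c : ℤ, b ^ 2 + 15 = 4 * p * c := by
    rcases eq_or_ne p 2 with rfl | hp2
    · exact ⟨1, 2, by norm_num⟩
    rw [chiInt_prime_eq_legendreSym p hp2 hp3 hp5] at hchi
    obtain ⟨z, hz⟩ : ∃ z : ℤ, (p : ℤ) ∣ z ^ 2 + 15 := by
      have hne : ((-15 : ℤ) : ZMod p) ≠ 0 := by
        intro h0
        rw [← legendreSym.eq_zero_iff] at h0
        omega
      obtain ⟨y, hy⟩ := (legendreSym.eq_one_iff p hne).1 hchi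
      refine ⟨(y.val : ℤ), ?_⟩
      rw [← ZMod.intCast_zmod_eq_zero_iff_dvd _ p]
      push_cast
      rw [ZMod.natCast_zmod_val]
      push_cast at hy
      linear_combination -hy
    have hodd : (p : ℤ) % 2 = 1 := by have := Nat.odd_iff.1 (hp.odd_of_ne_two hp2); omega
    obtain ⟨w, hw, hw2⟩ : ∃ w : ℤ, (p : ℤ) ∣ w ^ 2 + 15 ∧ w % 2 = 1 := by
      rcases Int.emod_two_eq_zero_or_one z with h0 | h1
      · refine ⟨z + p, ?_, by omega⟩
        have : (z + p) ^ 2 + 15 = (z ^ 2 + 15) + p * (2 * z + p) := by ring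
        rw [this]
        exact dvd_add hz (dvd_mul_right _ _)
      · exact ⟨z, hz, h1⟩
    have h4 : (4 : ℤ) ∣ w ^ 2 + 15 := by
      obtain ⟨k, hk⟩ : ∃ k, w = 2 * k + 1 := ⟨w / 2, by omega⟩
      exact ⟨k ^ 2 + k + 4, by rw [hk]; ring⟩
    have hcop : IsCoprime (4 : ℤ) p := by
      have : IsCoprime (2 : ℤ) p := by
        rw [Int.isCoprime_iff_gcd_eq_one]
        have := (Nat.coprime_primes Nat.prime_two hp).2 (Ne.symm hp2)
        exact_mod_cast this
      simpa using this.pow_left (m := 2)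
    obtain ⟨c, hc⟩ := hcop.mul_dvd h4 hw
    exact ⟨w, c, hc⟩
  obtain ⟨x, q, r, s, H⟩ := exists_reduction_disc_neg_fifteen p b c hp.pos h
  refine ⟨x, r, H.imp (fun H ↦ ?_) (fun H ↦ ?_)⟩
  · have := H 1 0
    linear_combination -this
  · have := H 1 0
    linear_combination -this

theorem emod_two_eq_of_mem_ellipsePoints {a b n : ℤ} (ha : a % 2 = 1) (hb : b % 2 = 1)
    {w : ℤ × ℤ} (hw : w ∈ ellipsePoints a b n) : w.1 % 2 = w.2 % 2 := by
  have h : a * w.1 ^ 2 + b * w.2 ^ 2 = 4 * n := hw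
  have h2 : (a * w.1 ^ 2 + b * w.2 ^ 2) % 2 = 0 := by omega
  rcases Int.emod_two_eq_zero_or_one w.1 with h3 | h3 <;>
    rcases Int.emod_two_eq_zero_or_one w.2 with h4 | h4 <;>
    simp [Int.add_emod, Int.mul_emod, pow_two, ha, hb, h3, h4] at h2 ⊢

/-- Composition of a point of type `(a, b)` with `(u, v)`; the numerators are the coordinates of
`(x√a + y√-b)(u√e + v√-f)`. -/
def composePoint (k : ℤ × ℤ × ℤ × ℤ) (u v : ℤ) (w : ℤ × ℤ) : ℤ × ℤ :=
  ((k.1 * w.1 * u - k.2.1 * w.2 * v) / 2, (k.2.2.1 * w.1 * v + k.2.2.2 * w.2 * u) / 2)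

/-- Numerical relations saying that `(a, b)` composed with `(e, f)` gives `(c, d)`, where
`√(ae) = k₁√c`, `√(bf) = k₂√c`, `√(af) = k₃√d`, `√(be) = k₄√d`, and conversely with `l`. -/
structure Composable (a b e f c d : ℤ) (k l : ℤ × ℤ × ℤ × ℤ) : Prop where
  ae : a * e = k.1 ^ 2 * c
  bf : b * f = k.2.1 ^ 2 * c
  af : a * f = k.2.2.1 ^ 2 * d
  be : b * e = k.2.2.2 ^ 2 * d
  k12 : k.1 * k.2.1 * c = k.2.2.1 * k.2.2.2 * d
  ce : c * e = l.1 ^ 2 * a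
  df : d * f = l.2.1 ^ 2 * a
  cf : c * f = l.2.2.1 ^ 2 * b
  de : d * e = l.2.2.2 ^ 2 * b
  l12 : l.1 * l.2.1 * a = l.2.2.1 * l.2.2.2 * b
  e11 : k.1 * l.1 = e
  e44 : k.2.2.2 * l.2.2.2 = e
  f23 : k.2.1 * l.2.2.1 = f
  f32 : k.2.2.1 * l.2.1 = f
  x1 : k.1 * l.2.2.1 = k.2.2.1 * l.2.2.2
  x2 : k.2.1 * l.1 = k.2.2.2 * l.2.1
  y1 : k.1 * l.2.1 = k.2.1 * l.2.2.2
  y2 : k.2.2.2 * l.2.2.1 = k.2.2.1 * l.1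
  aodd : a % 2 = 1
  bodd : b % 2 = 1
  codd : c % 2 = 1
  dodd : d % 2 = 1
  eodd : e % 2 = 1
  fodd : f % 2 = 1
  kodd : k.1 % 2 = 1 ∧ k.2.1 % 2 = 1 ∧ k.2.2.1 % 2 = 1 ∧ k.2.2.2 % 2 = 1
  lodd : l.1 % 2 = 1 ∧ l.2.1 % 2 = 1 ∧ l.2.2.1 % 2 = 1 ∧ l.2.2.2 % 2 = 1
  apos : 0 < a ∧ 0 < b ∧ 0 < c ∧ 0 < d
  dvd15 : a ∣ 15 ∧ b ∣ 15 ∧ c ∣ 15 ∧ d ∣ 15 ∧ e ∣ 15 ∧ f ∣ 15 ∧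
    l.2.2.1 ∣ 15 ∧ l.2.2.2 ∣ 15
  cd8 : (c + d) % 8 = 0

theorem composable_one_one : Composable 1 15 1 15 1 15 (1, 15, 1, 1) (1, 15, 1, 1) := by
  constructor <;> norm_num
theorem composable_five_one : Composable 5 3 1 15 5 3 (1, 3, 5, 1) (1, 3, 5, 1) := by
  constructor <;> norm_num
theorem composable_one_five : Composable 1 15 5 3 5 3 (1, 3, 1, 5) (5, 3, 1, 1) := by
  constructor <;> norm_num
theorem composable_five_five : Composable 5 3 5 3 1 15 (5, 3, 1, 1) (1, 3, 1, 5) := by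
  constructor <;> norm_num

section Composition

variable {a b e f c d : ℤ} {k l : ℤ × ℤ × ℤ × ℤ}

theorem Composable.two_mul_composePoint (H : Composable a b e f c d k l) {u v m n : ℤ}
    (huv : (u, v) ∈ ellipsePoints e f m) {w : ℤ × ℤ} (hw : w ∈ ellipsePoints a b n) :
    2 * (composePoint k u v w).1 = k.1 * w.1 * u - k.2.1 * w.2 * v ∧
      2 * (composePoint k u v w).2 = k.2.2.1 * w.1 * v + k.2.2.2 * w.2 * u := by
  have h1 := emod_two_eq_of_mem_ellipsePoints H.aodd H.bodd hw
  have h2 : u % 2 = v % 2 := emod_two_eq_of_mem_ellipsePoints H.eodd H.fodd huv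
  obtain ⟨k1, k2, k3, k4⟩ := H.kodd
  constructor
  · refine Int.mul_ediv_cancel' (Int.dvd_of_emod_eq_zero ?_)
    rcases Int.emod_two_eq_zero_or_one w.2 with h3 | h3 <;>
    rcases Int.emod_two_eq_zero_or_one v with h4 | h4 <;>
    simp [Int.sub_emod, Int.mul_emod, h1, h2, h3, h4, k1, k2]
  · refine Int.mul_ediv_cancel' (Int.dvd_of_emod_eq_zero ?_)
    rcases Int.emod_two_eq_zero_or_one w.2 with h3 | h3 <;>
    rcases Int.emod_two_eq_zero_or_one v with h4 | h4 <;>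
    simp [Int.add_emod, Int.mul_emod, h1, h2, h3, h4, k3, k4]

theorem Composable.composePoint_mem (H : Composable a b e f c d k l) {u v m n : ℤ}
    (huv : (u, v) ∈ ellipsePoints e f m) {w : ℤ × ℤ} (hw : w ∈ ellipsePoints a b n) :
    composePoint k u v w ∈ ellipsePoints c d (m * n) := by
  obtain ⟨h1, h2⟩ := H.two_mul_composePoint huv hw
  have hw' : a * w.1 ^ 2 + b * w.2 ^ 2 = 4 * n := hw
  have huv' : e * u ^ 2 + f * v ^ 2 = 4 * m := huv
  show c * (composePoint k u v w).1 ^ 2 + d * (composePoint k u v w).2 ^ 2 = 4 * (m * n)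
  have : 4 * (c * (composePoint k u v w).1 ^ 2 + d * (composePoint k u v w).2 ^ 2) =
      4 * (4 * (m * n)) := by
    calc _ = c * (2 * (composePoint k u v w).1) ^ 2 +
          d * (2 * (composePoint k u v w).2) ^ 2 := by ring
      _ = (a * w.1 ^ 2 + b * w.2 ^ 2) * (e * u ^ 2 + f * v ^ 2) := by
          rw [h1, h2]
          linear_combination (-(w.1 * u) ^ 2) * H.ae - (w.2 * v) ^ 2 * H.bf
            - (w.1 * v) ^ 2 * H.af - (w.2 * u) ^ 2 * H.be - 2 * w.1 * w.2 * u * v * H.k12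
      _ = _ := by rw [hw', huv']; ring
  linarith

theorem Composable.composePoint_injOn (H : Composable a b e f c d k l) {u v m n : ℤ}
    (hm : m ≠ 0) (huv : (u, v) ∈ ellipsePoints e f m) :
    Set.InjOn (composePoint k u v) (ellipsePoints a b n) := by
  intro w hw w' hw' h
  obtain ⟨h1, h2⟩ := H.two_mul_composePoint huv hw
  obtain ⟨h3, h4⟩ := H.two_mul_composePoint huv hw'
  have huv' : e * u ^ 2 + f * v ^ 2 = 4 * m := huv
  rw [h] at h1 h2
  have e1 := h1.symm.trans h3
  have e2 := h2.symm.trans h4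
  have f1 : 4 * m * (w.1 - w'.1) = 0 := by
    rw [← huv']
    linear_combination (l.1 * u) * e1 + (l.2.1 * v) * e2 - (w.1 - w'.1) * u ^ 2 * H.e11
      - (w.1 - w'.1) * v ^ 2 * H.f32 + (w.2 - w'.2) * u * v * H.x2
  have f2 : 4 * m * (w.2 - w'.2) = 0 := by
    rw [← huv']
    linear_combination (-l.2.2.1 * v) * e1 + (l.2.2.2 * u) * e2 - (w.2 - w'.2) * u ^ 2 * H.e44
      - (w.2 - w'.2) * v ^ 2 * H.f23 + (w.1 - w'.1) * u * v * H.x1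
  have hm' : 4 * m ≠ 0 := by omega
  ext
  · have := (mul_eq_zero.1 f1).resolve_left hm'; omega
  · have := (mul_eq_zero.1 f2).resolve_left hm'; omega

/-- If the second coordinate of the conjugate composition is divisible by `2 p`, the point is
in the image of the composition. -/
theorem Composable.exists_composePoint_eq (H : Composable a b e f c d k l) {u v n : ℤ} {p : ℕ}
    (hp : p.Prime) (hp3 : p ≠ 3) (hp5 : p ≠ 5)
    (huv : (u, v) ∈ ellipsePoints e f p) {w : ℤ × ℤ} (hw : w ∈ ellipsePoints c d (p * n))
    (hdvd : (2 * p : ℤ) ∣ l.2.2.2 * w.2 * u - l.2.2.1 * w.1 * v) :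
    ∃ x ∈ ellipsePoints a b n, composePoint k u v x = w := by
  have hw' : c * w.1 ^ 2 + d * w.2 ^ 2 = 4 * (p * n) := hw
  have huv' : e * u ^ 2 + f * v ^ 2 = 4 * p := huv
  have hp0 : (p : ℤ) ≠ 0 := by exact_mod_cast hp.ne_zero
  have hpZ : Prime (p : ℤ) := Nat.prime_iff_prime_int.1 hp
  obtain ⟨y, hy⟩ := hdvd
  set z := l.1 * w.1 * u + l.2.1 * w.2 * v with hz
  have hnorm : a * z ^ 2 + b * (2 * p * y) ^ 2 = 16 * p ^ 2 * n := by
    rw [← hy, hz]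
    calc _ = (c * w.1 ^ 2 + d * w.2 ^ 2) * (e * u ^ 2 + f * v ^ 2) := by
          linear_combination (-(w.1 * u) ^ 2) * H.ce - (w.2 * v) ^ 2 * H.df
            - (w.1 * v) ^ 2 * H.cf - (w.2 * u) ^ 2 * H.de + 2 * w.1 * w.2 * u * v * H.l12
      _ = _ := by rw [hw', huv']; ring
  have hcop : IsCoprime (a : ℤ) (2 * p) := by
    have h15 : IsCoprime (15 : ℤ) (2 * p) := by
      refine IsCoprime.mul_right (by norm_num) ?_
      have h3 := (Nat.coprime_primes Nat.prime_three hp).2 (Ne.symm hp3)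
      have h5 := (Nat.coprime_primes Nat.prime_five hp).2 (Ne.symm hp5)
      have := Nat.Coprime.mul_left h3 h5
      exact_mod_cast Nat.Coprime.isCoprime this
    exact h15.of_isCoprime_of_dvd_left H.dvd15.1
  have hz2 : (2 * p : ℤ) ∣ z := by
    have h1 : ((2 * p : ℤ)) ^ 2 ∣ a * z ^ 2 := ⟨4 * n - b * y ^ 2, by linear_combination hnorm⟩
    have h2 : ((2 * p : ℤ)) ^ 2 ∣ z ^ 2 :=
      (IsCoprime.pow_left (m := 2) hcop.symm).dvd_of_dvd_mul_left h1
    exact (Int.pow_dvd_pow_iff two_ne_zero).1 h2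
  obtain ⟨x, hx⟩ := hz2
  have hxy : (x, y) ∈ ellipsePoints a b n := by
    show a * x ^ 2 + b * y ^ 2 = 4 * n
    rw [hx] at hnorm
    have : (4 * (p : ℤ) ^ 2) * (a * x ^ 2 + b * y ^ 2) = (4 * (p : ℤ) ^ 2) * (4 * n) := by
      linear_combination hnorm
    exact mul_left_cancel₀ (by positivity) this
  refine ⟨(x, y), hxy, ?_⟩
  obtain ⟨h1, h2⟩ := H.two_mul_composePoint huv hxy
  simp only at h1 h2
  have f1 : (4 * p : ℤ) * (composePoint k u v (x, y)).1 = (4 * p) * w.1 := by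
    calc _ = 2 * p * (2 * (composePoint k u v (x, y)).1) := by ring
      _ = k.1 * (2 * p * x) * u - k.2.1 * (2 * p * y) * v := by rw [h1]; ring
      _ = (e * u ^ 2 + f * v ^ 2) * w.1 := by
        rw [← hx, ← hy, hz]
        linear_combination w.1 * u ^ 2 * H.e11 + w.1 * v ^ 2 * H.f23 + w.2 * u * v * H.y1
      _ = _ := by rw [huv']
  have f2 : (4 * p : ℤ) * (composePoint k u v (x, y)).2 = (4 * p) * w.2 := by
    calc _ = 2 * p * (2 * (composePoint k u v (x, y)).2) := by ring
      _ = k.2.2.1 * (2 * p * x) * v + k.2.2.2 * (2 * p * y) * u := by rw [h2]; ring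
      _ = (e * u ^ 2 + f * v ^ 2) * w.2 := by
        rw [← hx, ← hy, hz]
        linear_combination w.2 * u ^ 2 * H.e44 + w.2 * v ^ 2 * H.f32 - w.1 * u * v * H.y2
      _ = _ := by rw [huv']
  have h4p : (4 * p : ℤ) ≠ 0 := by positivity
  ext
  · exact mul_left_cancel₀ h4p f1
  · exact mul_left_cancel₀ h4p f2

theorem ellipsePoints_neg_snd {a b n u v : ℤ} (h : (u, v) ∈ ellipsePoints a b n) :
    (u, -v) ∈ ellipsePoints a b n := by
  have h : a * u ^ 2 + b * v ^ 2 = 4 * n := h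
  show a * u ^ 2 + b * (-v) ^ 2 = 4 * n
  linarith [neg_sq v]

theorem not_dvd_of_mem_ellipsePoints_prime {e f u v : ℤ} {p : ℕ} (hp : p.Prime)
    (he : IsCoprime (p : ℤ) e) (hf : IsCoprime (p : ℤ) f) (hp2 : p ≠ 2)
    (h : (u, v) ∈ ellipsePoints e f p) :
    ¬ (p : ℤ) ∣ u ∧ ¬ (p : ℤ) ∣ v := by
  have h : e * u ^ 2 + f * v ^ 2 = 4 * p := h
  have hpZ : Prime (p : ℤ) := Nat.prime_iff_prime_int.1 hp
  have key : ¬ ((p : ℤ) ∣ u ∧ (p : ℤ) ∣ v) := by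
    rintro ⟨⟨x, rfl⟩, ⟨y, rfl⟩⟩
    have h1 : (p : ℤ) * (e * x ^ 2 + f * y ^ 2) = 4 := by
      have : (p : ℤ) * ((p : ℤ) * (e * x ^ 2 + f * y ^ 2)) = p * 4 := by linear_combination h
      exact mul_left_cancel₀ hpZ.ne_zero this
    have h2 : (p : ℤ) ∣ 2 ^ 2 := Dvd.intro _ (h1.trans (by norm_num))
    have h3 : p ∣ 2 := by exact_mod_cast hpZ.dvd_of_dvd_pow h2
    exact hp2 ((Nat.prime_dvd_prime_iff_eq hp Nat.prime_two).1 h3)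
  have hu : (p : ℤ) ∣ u → (p : ℤ) ∣ v := by
    rintro ⟨x, rfl⟩
    have : (p : ℤ) ∣ f * v ^ 2 := ⟨4 - e * p * x ^ 2, by linear_combination h⟩
    exact hpZ.dvd_of_dvd_pow (hf.dvd_of_dvd_mul_left this)
  have hv : (p : ℤ) ∣ v → (p : ℤ) ∣ u := by
    rintro ⟨x, rfl⟩
    have : (p : ℤ) ∣ e * u ^ 2 := ⟨4 - f * p * x ^ 2, by linear_combination h⟩
    exact hpZ.dvd_of_dvd_pow (he.dvd_of_dvd_mul_left this)
  exact ⟨fun h ↦ key ⟨h, hu h⟩, fun h ↦ key ⟨hv h, h⟩⟩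

theorem isCoprime_of_dvd_fifteen {p : ℕ} (hp : p.Prime) (hp3 : p ≠ 3) (hp5 : p ≠ 5) {x : ℤ}
    (hx : x ∣ 15) : IsCoprime (p : ℤ) x := by
  have h3 := (Nat.coprime_primes hp Nat.prime_three).2 hp3
  have h5 := (Nat.coprime_primes hp Nat.prime_five).2 hp5
  have := Nat.Coprime.mul_right h3 h5
  have h : IsCoprime (p : ℤ) 15 := by exact_mod_cast Nat.Coprime.isCoprime this
  exact h.of_isCoprime_of_dvd_right hx

theorem not_dvd_of_mul_mul {p : ℕ} (hp : p.Prime) {x y z : ℤ} (hx : IsCoprime (p : ℤ) x)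
    (hz : ¬ (p : ℤ) ∣ z) (h : (p : ℤ) ∣ x * y * z) : (p : ℤ) ∣ y := by
  have hpZ : Prime (p : ℤ) := Nat.prime_iff_prime_int.1 hp
  exact hx.dvd_of_dvd_mul_left ((hpZ.dvd_or_dvd h).resolve_right hz)

theorem Composable.dvd_or_dvd (H : Composable a b e f c d k l) {u v n : ℤ} {p : ℕ}
    (hp : p.Prime) (hp3 : p ≠ 3) (hp5 : p ≠ 5)
    (huv : (u, v) ∈ ellipsePoints e f p) (huv2 : p = 2 → u % 2 = 1 ∧ v % 2 = 1)
    {w : ℤ × ℤ} (hw : w ∈ ellipsePoints c d (p * n)) :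
    (2 * p : ℤ) ∣ l.2.2.2 * w.2 * u - l.2.2.1 * w.1 * v ∨
      (2 * p : ℤ) ∣ l.2.2.2 * w.2 * u + l.2.2.1 * w.1 * v := by
  have hpar := emod_two_eq_of_mem_ellipsePoints H.codd H.dodd hw
  obtain ⟨-, -, l3, l4⟩ := H.lodd
  obtain ⟨s, t⟩ := w
  have hw' : c * s ^ 2 + d * t ^ 2 = 4 * (p * n) := hw
  have huv' : e * u ^ 2 + f * v ^ 2 = 4 * p := huv
  have hcf := H.cf
  have hde := H.de
  simp only at hpar ⊢
  generalize l.2.2.1 = m3 at *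
  generalize l.2.2.2 = m4 at *
  rcases eq_or_ne p 2 with rfl | hp2
  · obtain ⟨hu, hv⟩ := huv2 rfl
    obtain ⟨u, rfl⟩ : ∃ u', u = 2 * u' + 1 := ⟨u / 2, by omega⟩
    obtain ⟨v, rfl⟩ : ∃ v', v = 2 * v' + 1 := ⟨v / 2, by omega⟩
    rcases Int.emod_two_eq_zero_or_one t with ht | ht
    · obtain ⟨t, rfl⟩ : ∃ t', t = 2 * t' := ⟨t / 2, by omega⟩
      obtain ⟨s, rfl⟩ : ∃ s', s = 2 * s' := ⟨s / 2, by omega⟩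
      have h2 : s % 2 = t % 2 := by
        have h3 : (c * s ^ 2 + d * t ^ 2) % 2 = 0 := by
          have : c * s ^ 2 + d * t ^ 2 = 2 * n := by push_cast at hw'; linarith
          omega
        have hc := H.codd
        have hd := H.dodd
        rcases Int.emod_two_eq_zero_or_one s with h4 | h4 <;>
          rcases Int.emod_two_eq_zero_or_one t with h5 | h5 <;>
          simp [Int.add_emod, Int.mul_emod, pow_two, hc, hd, h4, h5] at h3 ⊢
      left
      have h5 : (m4 * t * (2 * u + 1) - m3 * s * (2 * v + 1)) % 2 = 0 := by
        rcases Int.emod_two_eq_zero_or_one t with h4 | h4 <;>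
          simp [Int.sub_emod, Int.add_emod, Int.mul_emod, l3, l4, h2, h4]
      obtain ⟨y, hy⟩ := Int.dvd_of_emod_eq_zero h5
      exact ⟨y, by push_cast; linear_combination 2 * hy⟩
    · have h1 : (m4 * t * (2 * u + 1)) % 2 = 1 := by
        simp [Int.add_emod, Int.mul_emod, l4, ht]
      have h2 : (m3 * s * (2 * v + 1)) % 2 = 1 := by
        simp [Int.add_emod, Int.mul_emod, l3, hpar, ht]
      push_cast
      omega
  · have hodd : (p : ℤ) % 2 = 1 := by have := Nat.odd_iff.1 (hp.odd_of_ne_two hp2); omega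
    have hpZ : Prime (p : ℤ) := Nat.prime_iff_prime_int.1 hp
    have hcop2 : IsCoprime (2 : ℤ) p := by
      have := (Nat.coprime_primes Nat.prime_two hp).2 (Ne.symm hp2)
      exact_mod_cast Nat.Coprime.isCoprime this
    have huvpar : u % 2 = v % 2 := emod_two_eq_of_mem_ellipsePoints H.eodd H.fodd huv
    have key : (p : ℤ) ∣ b * ((m4 * t * u - m3 * s * v) * (m4 * t * u + m3 * s * v)) := by
      refine ⟨4 * (d * t ^ 2) - 4 * n * f * v ^ 2, ?_⟩
      linear_combination (-(t * u) ^ 2) * hde + (s * v) ^ 2 * hcf + d * t ^ 2 * huv'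
        - f * v ^ 2 * hw'
    have key2 := (isCoprime_of_dvd_fifteen hp hp3 hp5 H.dvd15.2.1).dvd_of_dvd_mul_left key
    have even1 : (2 : ℤ) ∣ m4 * t * u - m3 * s * v := by
      refine Int.dvd_of_emod_eq_zero ?_
      rcases Int.emod_two_eq_zero_or_one t with h4 | h4 <;>
      rcases Int.emod_two_eq_zero_or_one v with h5 | h5 <;>
        simp [Int.sub_emod, Int.mul_emod, l3, l4, huvpar, hpar, h4, h5]
    have even2 : (2 : ℤ) ∣ m4 * t * u + m3 * s * v := by
      refine Int.dvd_of_emod_eq_zero ?_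
      rcases Int.emod_two_eq_zero_or_one t with h4 | h4 <;>
      rcases Int.emod_two_eq_zero_or_one v with h5 | h5 <;>
        simp [Int.add_emod, Int.mul_emod, l3, l4, huvpar, hpar, h4, h5]
    exact (hpZ.dvd_or_dvd key2).imp (hcop2.mul_dvd even1) (hcop2.mul_dvd even2)

/-- The numerators of the inverse composition of a composed point. -/
theorem Composable.numerator_composePoint (H : Composable a b e f c d k l) {u v m n : ℤ}
    (huv : (u, v) ∈ ellipsePoints e f m) {x : ℤ × ℤ} (hx : x ∈ ellipsePoints a b n) :
    l.2.2.2 * (composePoint k u v x).2 * u - l.2.2.1 * (composePoint k u v x).1 * v =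
      2 * m * x.2 := by
  obtain ⟨h1, h2⟩ := H.two_mul_composePoint huv hx
  have huv' : e * u ^ 2 + f * v ^ 2 = 4 * m := huv
  have : 2 * (l.2.2.2 * (composePoint k u v x).2 * u -
      l.2.2.1 * (composePoint k u v x).1 * v) = 2 * (2 * m * x.2) := by
    linear_combination (l.2.2.2 * u) * h2 - (l.2.2.1 * v) * h1 + x.2 * huv'
      + x.2 * u ^ 2 * H.e44 + x.2 * v ^ 2 * H.f23 - x.1 * u * v * H.x1
  linarith

/-- The points of type `(c, d)` at level `p n` which are divisible by `p`. -/
theorem ncard_divisible_ellipsePoints {p : ℕ} (hp : p.Prime) (hcodd : c % 2 = 1)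
    (hdodd : d % 2 = 1) (hcd : (c + d) % 8 = 0) (n : ℕ) :
    {w ∈ ellipsePoints c d (p * n) | (p : ℤ) ∣ w.1 ∧ (p : ℤ) ∣ w.2}.ncard =
      if p ∣ n then (ellipsePoints c d (n / p : ℕ)).ncard else 0 := by
  have hp0 : (p : ℤ) ≠ 0 := by exact_mod_cast hp.ne_zero
  have hpZ : Prime (p : ℤ) := Nat.prime_iff_prime_int.1 hp
  split_ifs with h
  · obtain ⟨m, rfl⟩ := h
    rw [Nat.mul_div_cancel_left _ hp.pos]
    have : {w ∈ ellipsePoints c d (p * (p * m : ℕ)) | (p : ℤ) ∣ w.1 ∧ (p : ℤ) ∣ w.2} =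
        (fun w : ℤ × ℤ ↦ ((p : ℤ) * w.1, (p : ℤ) * w.2)) '' ellipsePoints c d m := by
      ext ⟨s, t⟩
      simp only [ellipsePoints, Set.mem_ofPred_eq, Set.mem_image, Prod.exists, Prod.mk.injEq]
      constructor
      · rintro ⟨h, ⟨x, rfl⟩, ⟨y, rfl⟩⟩
        refine ⟨x, y, ?_, rfl, rfl⟩
        have : (p : ℤ) ^ 2 * (c * x ^ 2 + d * y ^ 2) = (p : ℤ) ^ 2 * (4 * m) := by
          push_cast at h; linear_combination h
        exact mul_left_cancel₀ (pow_ne_zero 2 hp0) this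
      · rintro ⟨x, y, h, rfl, rfl⟩
        refine ⟨?_, dvd_mul_right _ _, dvd_mul_right _ _⟩
        push_cast
        linear_combination (p : ℤ) ^ 2 * h
    rw [this, Set.ncard_image_of_injective]
    rintro ⟨x, y⟩ ⟨x', y'⟩ h
    simp only [Prod.mk.injEq, mul_eq_mul_left_iff, hp0, or_false] at h
    ext <;> simp [h]
  · suffices hE : {w ∈ ellipsePoints c d (p * n) | (p : ℤ) ∣ w.1 ∧ (p : ℤ) ∣ w.2} = ∅ by
      rw [hE, Set.ncard_empty]
    refine Set.eq_empty_of_forall_notMem ?_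
    rintro ⟨s, t⟩ ⟨hw, ⟨x, hx⟩, ⟨y, hy⟩⟩
    simp only at hx hy
    subst hx hy
    have hw : c * (p * x) ^ 2 + d * (p * y) ^ 2 = 4 * (p * n) := hw
    have h1 : (p : ℤ) * (c * x ^ 2 + d * y ^ 2) = 4 * n := by
      have : (p : ℤ) * (p * (c * x ^ 2 + d * y ^ 2)) = p * (4 * n) := by linear_combination hw
      exact mul_left_cancel₀ hp0 this
    rcases eq_or_ne p 2 with rfl | hp2
    · have h2 : c * x ^ 2 + d * y ^ 2 = 2 * n := by push_cast at h1; linarith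
      have h3 : (c * x ^ 2 + d * y ^ 2) % 2 = 0 := by omega
      have h4 : x % 2 = y % 2 := by
        rcases Int.emod_two_eq_zero_or_one x with h4 | h4 <;>
          rcases Int.emod_two_eq_zero_or_one y with h5 | h5 <;>
          simp [Int.add_emod, Int.mul_emod, pow_two, hcodd, hdodd, h4, h5] at h3 ⊢
      have h5 : ∃ r, c * x ^ 2 + d * y ^ 2 = 4 * r := by
        obtain ⟨j, hj⟩ : ∃ j, c + d = 4 * j := ⟨(c + d) / 4, by omega⟩
        rcases Int.emod_two_eq_zero_or_one y with hy | hy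
        · obtain ⟨y', rfl⟩ : ∃ y', y = 2 * y' := ⟨y / 2, by omega⟩
          obtain ⟨x', rfl⟩ : ∃ x', x = 2 * x' := ⟨x / 2, by omega⟩
          exact ⟨c * x' ^ 2 + d * y' ^ 2, by ring⟩
        · obtain ⟨y', rfl⟩ : ∃ y', y = 2 * y' + 1 := ⟨y / 2, by omega⟩
          obtain ⟨x', rfl⟩ : ∃ x', x = 2 * x' + 1 := ⟨x / 2, by omega⟩
          exact ⟨c * (x' ^ 2 + x') + d * (y' ^ 2 + y') + j, by linear_combination hj⟩
      obtain ⟨r, hr⟩ := h5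
      omega
    · have h2 : (p : ℤ) ∣ 2 ^ 2 * n := Dvd.intro _ (h1.trans (by norm_num))
      rcases hpZ.dvd_or_dvd h2 with h3 | h3
      · have : p ∣ 2 := by exact_mod_cast hpZ.dvd_of_dvd_pow h3
        exact hp2 ((Nat.prime_dvd_prime_iff_eq hp Nat.prime_two).1 this)
      · exact h (by exact_mod_cast h3)

theorem Composable.ncard_ellipsePoints_prime_mul (H : Composable a b e f c d k l) {u v : ℤ}
    {p : ℕ} (hp : p.Prime) (hp3 : p ≠ 3) (hp5 : p ≠ 5)
    (huv : (u, v) ∈ ellipsePoints e f p) (huv2 : p = 2 → u % 2 = 1 ∧ v % 2 = 1) (n : ℕ) :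
    (ellipsePoints c d (p * n)).ncard +
      (if p ∣ n then (ellipsePoints c d (n / p : ℕ)).ncard else 0) =
      2 * (ellipsePoints a b n).ncard := by
  obtain ⟨a0, b0, c0, d0⟩ := H.apos
  obtain ⟨-, -, -, -, he15, hf15, hl3, hl4⟩ := H.dvd15
  have hp0 : (p : ℤ) ≠ 0 := by exact_mod_cast hp.ne_zero
  have huv' := ellipsePoints_neg_snd huv
  set S := ellipsePoints a b n
  set T := ellipsePoints c d (p * n)
  have hSfin : S.Finite := ellipsePoints_finite a0 b0 n
  have hunion : composePoint k u v '' S ∪ composePoint k u (-v) '' S = T := by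
    apply Set.Subset.antisymm
    · rintro w (⟨x, hx, rfl⟩ | ⟨x, hx, rfl⟩)
      · exact H.composePoint_mem huv hx
      · exact H.composePoint_mem huv' hx
    · intro w hw
      rcases H.dvd_or_dvd hp hp3 hp5 huv huv2 hw with h | h
      · left
        obtain ⟨x, hx, hxw⟩ := H.exists_composePoint_eq hp hp3 hp5 huv hw h
        exact ⟨x, hx, hxw⟩
      · right
        obtain ⟨x, hx, hxw⟩ := H.exists_composePoint_eq hp hp3 hp5 huv' hw (by
          convert h using 1; ring)
        exact ⟨x, hx, hxw⟩
  have huvp : ¬ (p : ℤ) ∣ u ∧ ¬ (p : ℤ) ∣ v := by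
    rcases eq_or_ne p 2 with rfl | hp2
    · obtain ⟨h1, h2⟩ := huv2 rfl
      push_cast
      omega
    · exact not_dvd_of_mem_ellipsePoints_prime hp (isCoprime_of_dvd_fifteen hp hp3 hp5 he15)
        (isCoprime_of_dvd_fifteen hp hp3 hp5 hf15) hp2 huv
  have hinter : composePoint k u v '' S ∩ composePoint k u (-v) '' S =
      {w ∈ T | (p : ℤ) ∣ w.1 ∧ (p : ℤ) ∣ w.2} := by
    ext w
    constructor
    · rintro ⟨⟨x, hx, rfl⟩, ⟨y, hy, hyx⟩⟩
      refine ⟨H.composePoint_mem huv hx, ?_⟩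
      have h1 := H.numerator_composePoint huv hx
      have h2 := H.numerator_composePoint huv' hy
      rw [hyx] at h2
      constructor
      · refine not_dvd_of_mul_mul hp (isCoprime_of_dvd_fifteen hp hp3 hp5 hl3) huvp.2
          ⟨y.2 - x.2, ?_⟩
        linarith
      · refine not_dvd_of_mul_mul hp (isCoprime_of_dvd_fifteen hp hp3 hp5 hl4) huvp.1
          ⟨y.2 + x.2, ?_⟩
        linarith
    · rintro ⟨hw, hw1, hw2⟩
      obtain ⟨s, t⟩ := w
      obtain ⟨x, rfl⟩ : (p : ℤ) ∣ s := hw1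
      obtain ⟨y, rfl⟩ : (p : ℤ) ∣ t := hw2
      have hxy : x % 2 = y % 2 := by
        have h1 : (p * x) % 2 = (p * y) % 2 :=
          emod_two_eq_of_mem_ellipsePoints H.codd H.dodd hw
        rcases hp.eq_two_or_odd with rfl | hodd
        · have h2 : c * (2 * x) ^ 2 + d * (2 * y) ^ 2 = 4 * (2 * n) := hw
          have h3 : (c * x ^ 2 + d * y ^ 2) % 2 = 0 := by
            have : c * x ^ 2 + d * y ^ 2 = 2 * n := by linarith
            omega
          have hc := H.codd
          have hd := H.dodd
          rcases Int.emod_two_eq_zero_or_one x with h4 | h4 <;>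
            rcases Int.emod_two_eq_zero_or_one y with h5 | h5 <;>
            simp [Int.add_emod, Int.mul_emod, pow_two, hc, hd, h4, h5] at h3 ⊢
        · have hodd' : (p : ℤ) % 2 = 1 := by omega
          simpa [Int.mul_emod, hodd'] using h1
      have huvpar : u % 2 = v % 2 := emod_two_eq_of_mem_ellipsePoints H.eodd H.fodd huv
      obtain ⟨-, -, l3, l4⟩ := H.lodd
      constructor
      · obtain ⟨z, hz⟩ : (2 : ℤ) ∣ l.2.2.2 * y * u - l.2.2.1 * x * v := by
          refine Int.dvd_of_emod_eq_zero ?_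
          rcases Int.emod_two_eq_zero_or_one y with h4 | h4 <;>
          rcases Int.emod_two_eq_zero_or_one v with h5 | h5 <;>
            simp [Int.sub_emod, Int.mul_emod, l3, l4, huvpar, hxy, h4, h5]
        obtain ⟨r, hr, hrw⟩ := H.exists_composePoint_eq hp hp3 hp5 huv hw
          ⟨z, by linear_combination (p : ℤ) * hz⟩
        exact ⟨r, hr, hrw⟩
      · obtain ⟨z, hz⟩ : (2 : ℤ) ∣ l.2.2.2 * y * u + l.2.2.1 * x * v := by
          refine Int.dvd_of_emod_eq_zero ?_
          rcases Int.emod_two_eq_zero_or_one y with h4 | h4 <;>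
          rcases Int.emod_two_eq_zero_or_one v with h5 | h5 <;>
            simp [Int.add_emod, Int.mul_emod, l3, l4, huvpar, hxy, h4, h5]
        obtain ⟨r, hr, hrw⟩ := H.exists_composePoint_eq hp hp3 hp5 huv' hw
          ⟨z, by linear_combination (p : ℤ) * hz⟩
        exact ⟨r, hr, hrw⟩
  have hcard := Set.ncard_union_add_ncard_inter (composePoint k u v '' S)
    (composePoint k u (-v) '' S) (hSfin.image _) (hSfin.image _)
  rw [hunion, hinter, ncard_divisible_ellipsePoints hp H.codd H.dodd H.cd8,
    Set.InjOn.ncard_image (H.composePoint_injOn hp0 huv),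
    Set.InjOn.ncard_image (H.composePoint_injOn hp0 huv')] at hcard
  rw [hcard, two_mul]

end Composition

/-- The number of integer points on the ellipses `s² + 15 t² = 4 n` and `5 s² + 3 t² = 4 n`. -/
noncomputable def repCount (n : ℕ) : ℤ :=
  (ellipsePoints 1 15 n).ncard + (ellipsePoints 5 3 n).ncard

theorem odd_of_mem_ellipsePoints_two {e f u v : ℤ} (he : e % 2 = 1) (hef : (e + f) % 8 = 0)
    (h : (u, v) ∈ ellipsePoints e f 2) : u % 2 = 1 ∧ v % 2 = 1 := by
  have hpar : u % 2 = v % 2 := emod_two_eq_of_mem_ellipsePoints he (by omega) h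
  have h : e * u ^ 2 + f * v ^ 2 = 4 * 2 := h
  suffices v % 2 ≠ 0 by omega
  intro hv
  obtain ⟨y, rfl⟩ : ∃ y, v = 2 * y := ⟨v / 2, by omega⟩
  obtain ⟨x, rfl⟩ : ∃ x, u = 2 * x := ⟨u / 2, by omega⟩
  have h1 : e * x ^ 2 + f * y ^ 2 = 2 := by linarith
  obtain ⟨j, hj⟩ : ∃ j, e + f = 8 * j := ⟨(e + f) / 8, by omega⟩
  have h2 : e * ((x - y) * (x + y)) + 8 * (j * y ^ 2) = 2 := by
    linear_combination h1 - y ^ 2 * hj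
  have h3 : (x - y) % 2 = (x + y) % 2 := by omega
  rcases Int.emod_two_eq_zero_or_one (x + y) with h4 | h4
  · obtain ⟨s, hs⟩ : ∃ s, x + y = 2 * s := ⟨(x + y) / 2, by omega⟩
    obtain ⟨t, ht⟩ : ∃ t, x - y = 2 * t := ⟨(x - y) / 2, by omega⟩
    rw [hs, ht] at h2
    have : 4 * (e * t * s + 2 * (j * y ^ 2)) = 2 := by linear_combination h2
    omega
  · have : (e * ((x - y) * (x + y))) % 2 = 1 := by
      simp [Int.mul_emod, he, h3, h4]
    omega

theorem repCount_mul_of_split {p : ℕ} (hp : p.Prime) (hp3 : p ≠ 3) (hp5 : p ≠ 5)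
    (hchi : chiInt (p : ZMod 15) = 1) (n : ℕ) :
    repCount (p * n) + (if p ∣ n then repCount (n / p) else 0) = 2 * repCount n := by
  obtain ⟨u, v, h⟩ := exists_ellipse_point_of_split p hp hp3 hp5 hchi
  unfold repCount
  rcases h with h | h
  · have huv : (u, v) ∈ ellipsePoints 1 15 p := by
      show 1 * u ^ 2 + 15 * v ^ 2 = 4 * (p : ℤ)
      linarith
    have h2 : p = 2 → u % 2 = 1 ∧ v % 2 = 1 := by
      rintro rfl
      exact odd_of_mem_ellipsePoints_two (by norm_num) (by norm_num) huv
    have e1 := composable_one_one.ncard_ellipsePoints_prime_mul hp hp3 hp5 huv h2 n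
    have e2 := composable_five_one.ncard_ellipsePoints_prime_mul hp hp3 hp5 huv h2 n
    rw [Nat.cast_mul]
    split_ifs at e1 e2 ⊢ <;> omega
  · have huv : (u, v) ∈ ellipsePoints 5 3 p := h
    have h2 : p = 2 → u % 2 = 1 ∧ v % 2 = 1 := by
      rintro rfl
      exact odd_of_mem_ellipsePoints_two (by norm_num) (by norm_num) huv
    have e1 := composable_one_five.ncard_ellipsePoints_prime_mul hp hp3 hp5 huv h2 n
    have e2 := composable_five_five.ncard_ellipsePoints_prime_mul hp hp3 hp5 huv h2 n
    rw [Nat.cast_mul]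
    split_ifs at e1 e2 ⊢ <;> omega

theorem ncard_ellipsePoints_mul_of_inert {c d : ℤ} (hc : c % 2 = 1) (hd : d % 2 = 1)
    (hcd : (c + d) % 8 = 0) (hmul : c * d = 15) {p : ℕ} (hp : p.Prime) (hp2 : p ≠ 2)
    (hp3 : p ≠ 3) (hp5 : p ≠ 5) (hchi : chiInt (p : ZMod 15) = -1) (n : ℕ) :
    (ellipsePoints c d (p * n)).ncard =
      if p ∣ n then (ellipsePoints c d (n / p : ℕ)).ncard else 0 := by
  rw [← ncard_divisible_ellipsePoints hp hc hd hcd]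
  congr 1
  ext ⟨s, t⟩
  refine ⟨fun h ↦ ⟨h, ?_⟩, fun h ↦ h.1⟩
  have : Fact p.Prime := ⟨hp⟩
  have hpZ : Prime (p : ℤ) := Nat.prime_iff_prime_int.1 hp
  rw [chiInt_prime_eq_legendreSym p hp2 hp3 hp5, legendreSym.eq_neg_one_iff] at hchi
  have h : c * s ^ 2 + d * t ^ 2 = 4 * (p * n) := h
  have ht : (p : ℤ) ∣ t := by
    by_contra hcon
    apply hchi
    have ht0 : (t : ZMod p) ≠ 0 := by rwa [Ne, ZMod.intCast_zmod_eq_zero_iff_dvd]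
    refine ⟨c * s / t, ?_⟩
    have h1 : ((c * s) ^ 2 + 15 * t ^ 2 : ℤ) = p * (c * 4 * n) := by
      linear_combination c * h - t ^ 2 * hmul
    have h2 := congrArg (Int.cast : ℤ → ZMod p) h1
    push_cast at h2 ⊢
    rw [ZMod.natCast_self, zero_mul] at h2
    field_simp
    linear_combination -h2
  have hcop : IsCoprime (p : ℤ) c := isCoprime_of_dvd_fifteen hp hp3 hp5 ⟨d, hmul.symm⟩
  refine ⟨?_, ht⟩
  obtain ⟨y, hy⟩ := ht
  have : (p : ℤ) ∣ c * s ^ 2 := ⟨4 * n - d * p * y ^ 2, by rw [hy] at h; linear_combination h⟩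
  exact hpZ.dvd_of_dvd_pow (hcop.dvd_of_dvd_mul_left this)

theorem ncard_ellipsePoints_three_mul (n : ℕ) :
    (ellipsePoints 5 3 (3 * n)).ncard = (ellipsePoints 1 15 n).ncard ∧
      (ellipsePoints 1 15 (3 * n)).ncard = (ellipsePoints 5 3 n).ncard := by
  have hinj : Function.Injective (fun w : ℤ × ℤ ↦ (3 * w.2, w.1)) := by
    rintro ⟨a, b⟩ ⟨c, d⟩ h
    simp only [Prod.mk.injEq] at h
    ext
    · exact h.2
    · simp only; omega
  constructor
  · rw [← Set.ncard_image_of_injective (ellipsePoints 1 15 n) hinj]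
    congr 1
    ext ⟨s, t⟩
    simp only [ellipsePoints, Set.mem_ofPred_eq, Set.mem_image, Prod.exists, Prod.mk.injEq]
    constructor
    · intro h
      have h3 : (3 : ℤ) ∣ 5 * s ^ 2 := ⟨4 * n - t ^ 2, by linear_combination h⟩
      obtain ⟨y, rfl⟩ : (3 : ℤ) ∣ s := Int.prime_three.dvd_of_dvd_pow
        ((by norm_num : IsCoprime (3 : ℤ) 5).dvd_of_dvd_mul_left h3)
      exact ⟨t, y, by linarith, rfl, rfl⟩
    · rintro ⟨a, b, h, rfl, rfl⟩
      linarith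
  · rw [← Set.ncard_image_of_injective (ellipsePoints 5 3 n) hinj]
    congr 1
    ext ⟨s, t⟩
    simp only [ellipsePoints, Set.mem_ofPred_eq, Set.mem_image, Prod.exists, Prod.mk.injEq]
    constructor
    · intro h
      have h3 : (3 : ℤ) ∣ s ^ 2 := ⟨4 * n - 5 * t ^ 2, by linear_combination h⟩
      obtain ⟨y, rfl⟩ : (3 : ℤ) ∣ s := Int.prime_three.dvd_of_dvd_pow h3
      exact ⟨t, y, by linarith, rfl, rfl⟩
    · rintro ⟨a, b, h, rfl, rfl⟩
      linarith

theorem ncard_ellipsePoints_five_mul (n : ℕ) :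
    (ellipsePoints 5 3 (5 * n)).ncard = (ellipsePoints 1 15 n).ncard ∧
      (ellipsePoints 1 15 (5 * n)).ncard = (ellipsePoints 5 3 n).ncard := by
  have h5 : Prime (5 : ℤ) := Nat.prime_iff_prime_int.1 Nat.prime_five
  constructor
  · have hinj : Function.Injective (fun w : ℤ × ℤ ↦ (w.1, 5 * w.2)) := by
      rintro ⟨a, b⟩ ⟨c, d⟩ h
      simp only [Prod.mk.injEq] at h
      ext
      · exact h.1
      · simp only; omega
    rw [← Set.ncard_image_of_injective (ellipsePoints 1 15 n) hinj]
    congr 1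
    ext ⟨s, t⟩
    simp only [ellipsePoints, Set.mem_ofPred_eq, Set.mem_image, Prod.exists, Prod.mk.injEq]
    constructor
    · intro h
      have h3 : (5 : ℤ) ∣ 3 * t ^ 2 := ⟨4 * n - s ^ 2, by linear_combination h⟩
      obtain ⟨y, rfl⟩ : (5 : ℤ) ∣ t := h5.dvd_of_dvd_pow
        ((by norm_num : IsCoprime (5 : ℤ) 3).dvd_of_dvd_mul_left h3)
      exact ⟨s, y, by linarith, rfl, rfl⟩
    · rintro ⟨a, b, h, rfl, rfl⟩
      linarith
  · have hinj : Function.Injective (fun w : ℤ × ℤ ↦ (5 * w.1, w.2)) := by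
      rintro ⟨a, b⟩ ⟨c, d⟩ h
      simp only [Prod.mk.injEq] at h
      ext
      · simp only; omega
      · exact h.2
    rw [← Set.ncard_image_of_injective (ellipsePoints 5 3 n) hinj]
    congr 1
    ext ⟨s, t⟩
    simp only [ellipsePoints, Set.mem_ofPred_eq, Set.mem_image, Prod.exists, Prod.mk.injEq]
    constructor
    · intro h
      have h3 : (5 : ℤ) ∣ s ^ 2 := ⟨4 * n - 3 * t ^ 2, by linear_combination h⟩
      obtain ⟨y, rfl⟩ : (5 : ℤ) ∣ s := h5.dvd_of_dvd_pow h3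
      exact ⟨y, t, by linarith, rfl, rfl⟩
    · rintro ⟨a, b, h, rfl, rfl⟩
      linarith

theorem repCount_prime_mul {p : ℕ} (hp : p.Prime) (n : ℕ) :
    repCount (p * n) + (if p ∣ n then chiInt (p : ZMod 15) * repCount (n / p) else 0) =
      (1 + chiInt (p : ZMod 15)) * repCount n := by
  rcases eq_or_ne p 3 with rfl | hp3
  · have h0 : chiInt ((3 : ℕ) : ZMod 15) = 0 := by decide
    obtain ⟨h1, h2⟩ := ncard_ellipsePoints_three_mul n
    rw [h0]
    simp [repCount, h1, h2, add_comm]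
  rcases eq_or_ne p 5 with rfl | hp5
  · have h0 : chiInt ((5 : ℕ) : ZMod 15) = 0 := by decide
    obtain ⟨h1, h2⟩ := ncard_ellipsePoints_five_mul n
    rw [h0]
    simp [repCount, h1, h2, add_comm]
  rcases eq_or_ne (chiInt (p : ZMod 15)) 1 with h1 | h1
  · simpa [h1, one_add_one_eq_two] using repCount_mul_of_split hp hp3 hp5 h1 n
  have hp2 : p ≠ 2 := by rintro rfl; exact h1 (by decide)
  have hneg : chiInt (p : ZMod 15) = -1 := by
    have : Fact p.Prime := ⟨hp⟩
    rw [chiInt_prime_eq_legendreSym p hp2 hp3 hp5] at h1 ⊢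
    refine (legendreSym.eq_one_or_neg_one p ?_).resolve_left h1
    rw [Ne, ZMod.intCast_zmod_eq_zero_iff_dvd, dvd_neg]
    intro h
    have h15 : p ∣ 3 * 5 := by exact_mod_cast h
    rcases hp.dvd_mul.1 h15 with h | h
    · exact hp3 ((Nat.prime_dvd_prime_iff_eq hp Nat.prime_three).1 h)
    · exact hp5 ((Nat.prime_dvd_prime_iff_eq hp Nat.prime_five).1 h)
  have e1 := ncard_ellipsePoints_mul_of_inert (c := 1) (d := 15) (by norm_num) (by norm_num)
    (by norm_num) (by norm_num) hp hp2 hp3 hp5 hneg n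
  have e2 := ncard_ellipsePoints_mul_of_inert (c := 5) (d := 3) (by norm_num) (by norm_num)
    (by norm_num) (by norm_num) hp hp2 hp3 hp5 hneg n
  simp only [repCount, hneg]
  push_cast
  rw [e1, e2]
  split_ifs <;> simp

theorem sum_divisors_prime_mul (χ : MulChar (ZMod 15) ℤ) {p : ℕ} (hp : p.Prime) {n : ℕ}
    (hn : n ≠ 0) :
    ∑ d ∈ (p * n).divisors, χ (d : ZMod 15) +
        (if p ∣ n then χ (p : ZMod 15) * ∑ d ∈ (n / p).divisors, χ (d : ZMod 15) else 0) =
      (1 + χ (p : ZMod 15)) * ∑ d ∈ n.divisors, χ (d : ZMod 15) := by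
  have hsum (m : ℕ) : ∑ d ∈ m.divisors.image (p * ·), χ (d : ZMod 15) =
      χ (p : ZMod 15) * ∑ d ∈ m.divisors, χ (d : ZMod 15) := by
    rw [Finset.sum_image fun a _ b _ h ↦ Nat.eq_of_mul_eq_mul_left hp.pos h, Finset.mul_sum]
    simp
  have hunion : (p * n).divisors = n.divisors ∪ n.divisors.image (p * ·) := by
    ext d
    simp only [Nat.mem_divisors, Finset.mem_union, Finset.mem_image, ne_eq, mul_eq_zero, hn,
      hp.ne_zero, or_self, not_false_eq_true, and_true]
    constructor
    · intro h
      by_cases hpd : p ∣ d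
      · obtain ⟨e, rfl⟩ := hpd
        exact Or.inr ⟨e, Nat.dvd_of_mul_dvd_mul_left hp.pos h, rfl⟩
      · exact Or.inl (((Nat.Prime.coprime_iff_not_dvd hp).2 hpd).symm.dvd_of_dvd_mul_left h)
    · rintro (h | ⟨e, h, rfl⟩)
      · exact h.mul_left p
      · exact mul_dvd_mul_left p h
  have hinter : ∑ d ∈ n.divisors ∩ n.divisors.image (p * ·), χ (d : ZMod 15) =
      if p ∣ n then χ (p : ZMod 15) * ∑ d ∈ (n / p).divisors, χ (d : ZMod 15) else 0 := by
    split_ifs with h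
    · obtain ⟨m, rfl⟩ := h
      rw [Nat.mul_div_cancel_left _ hp.pos, ← hsum]
      congr 1
      ext d
      have hm : m ≠ 0 := by rintro rfl; simp at hn
      simp only [Nat.mem_divisors, Finset.mem_inter, Finset.mem_image, ne_eq, mul_eq_zero, hm,
        hp.ne_zero, or_self, not_false_eq_true, and_true]
      constructor
      · rintro ⟨h, e, -, rfl⟩
        exact ⟨e, Nat.dvd_of_mul_dvd_mul_left hp.pos h, rfl⟩
      · rintro ⟨e, h, rfl⟩
        exact ⟨mul_dvd_mul_left p h, e, h.mul_left p, rfl⟩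
    · refine Finset.sum_eq_zero fun d hd ↦ absurd ?_ h
      simp only [Nat.mem_divisors, Finset.mem_inter, Finset.mem_image] at hd
      obtain ⟨⟨h, -⟩, e, -, rfl⟩ := hd
      exact (dvd_mul_right p e).trans h
  rw [hunion, ← hinter, Finset.sum_union_inter, hsum]
  ring

theorem repCount_one : repCount 1 = 2 := by
  have h1 : ellipsePoints 1 15 ((1 : ℕ) : ℤ) = {(2, 0), (-2, 0)} := by
    ext ⟨s, t⟩
    simp only [ellipsePoints, Set.mem_ofPred_eq, Set.mem_insert_iff, Prod.mk.injEq,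
      Set.mem_singleton_iff]
    constructor
    · intro h
      have ht : t = 0 := by push_cast at h; nlinarith [sq_nonneg s, sq_nonneg t]
      subst ht
      have : (s - 2) * (s + 2) = 0 := by push_cast at h; linear_combination h
      rcases mul_eq_zero.1 this with h | h
      · left; omega
      · right; omega
    · rintro (⟨rfl, rfl⟩ | ⟨rfl, rfl⟩) <;> norm_num
  have h2 : ellipsePoints 5 3 ((1 : ℕ) : ℤ) = ∅ := by
    refine Set.eq_empty_of_forall_notMem ?_
    rintro ⟨s, t⟩ h
    have h : 5 * s ^ 2 + 3 * t ^ 2 = 4 := h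
    have hs : s = 0 := by nlinarith [sq_nonneg s, sq_nonneg t]
    subst hs
    omega
  rw [repCount, h1, h2, Set.ncard_pair (by simp), Set.ncard_empty]
  norm_num

theorem repCount_eq_sum_divisors {n : ℕ} (hn : n ≠ 0) :
    repCount n = 2 * ∑ d ∈ n.divisors, chiInt (d : ZMod 15) := by
  induction n using Nat.strong_induction_on with
  | _ n ih =>
  rcases eq_or_ne n 1 with rfl | hn1
  · rw [repCount_one]
    simp
  obtain ⟨p, hp, m, rfl⟩ := Nat.exists_prime_and_dvd hn1
  have hm : m ≠ 0 := by rintro rfl; simp at hn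
  have e1 := repCount_prime_mul hp m
  have e2 := sum_divisors_prime_mul chiInt hp hm
  rw [ih m (lt_mul_of_one_lt_left (Nat.pos_of_ne_zero hm) hp.one_lt) hm] at e1
  split_ifs at e1 e2 with h
  · obtain ⟨k, rfl⟩ := h
    have hk : k ≠ 0 := by rintro rfl; simp at hm
    rw [Nat.mul_div_cancel_left _ hp.pos] at e1 e2
    have hlt : k < p * (p * k) := by
      have := hp.two_le
      have := Nat.pos_of_ne_zero hk
      nlinarith [Nat.mul_le_mul hp.two_le hp.two_le]
    rw [ih k hlt hk] at e1
    linear_combination e1 - 2 * e2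
  · linear_combination e1 - 2 * e2

theorem integral_one_add_sq_rpow {s : ℝ} (hs : 1 / 2 < s) :
    ∫ t : ℝ, (1 + t ^ 2) ^ (-s) = √π * Real.Gamma (s - 1 / 2) / Real.Gamma s := by
  open MeasureTheory Set in
  have hs0 : 0 < s := by linarith
  have hG : Real.Gamma s ≠ 0 := (Real.Gamma_pos_of_pos hs0).ne'
  rw [eq_div_iff hG]
  have hpt (t : ℝ) : (1 + t ^ 2) ^ (-s) * Real.Gamma s =
      ∫ u in Ioi (0 : ℝ), u ^ (s - 1) * Real.exp (-((1 + t ^ 2) * u)) := by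
    have h0 : 0 < 1 + t ^ 2 := by positivity
    rw [Real.integral_rpow_mul_exp_neg_mul_Ioi hs0 h0, one_div, Real.inv_rpow h0.le,
      Real.rpow_neg h0.le]
  have hinner (u : ℝ) (hu : 0 < u) :
      ∫ t : ℝ, u ^ (s - 1) * Real.exp (-((1 + t ^ 2) * u)) =
        √π * (Real.exp (-u) * u ^ ((s - 1 / 2) - 1)) := by
    have h1 (t : ℝ) : u ^ (s - 1) * Real.exp (-((1 + t ^ 2) * u)) =
        u ^ (s - 1) * Real.exp (-u) * Real.exp (-u * t ^ 2) := by
      rw [mul_assoc, ← Real.exp_add]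
      ring_nf
    simp_rw [h1]
    rw [integral_const_mul, integral_gaussian, Real.sqrt_div Real.pi_nonneg,
      show s - 1 / 2 - 1 = (s - 1) - 1 / 2 by ring, Real.rpow_sub hu (s - 1) (1 / 2),
      Real.sqrt_eq_rpow u]
    ring
  have hint : Integrable (Function.uncurry fun (t u : ℝ) ↦
      u ^ (s - 1) * Real.exp (-((1 + t ^ 2) * u))) (volume.prod (volume.restrict (Ioi 0))) := by
    have hmeas : AEStronglyMeasurable (Function.uncurry fun (t u : ℝ) ↦
      u ^ (s - 1) * Real.exp (-((1 + t ^ 2) * u))) (volume.prod (volume.restrict (Ioi 0))) := by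
      refine Measurable.aestronglyMeasurable ?_
      unfold Function.uncurry
      fun_prop
    rw [integrable_prod_iff' hmeas]
    constructor
    · refine (ae_restrict_iff' measurableSet_Ioi).2 (Filter.Eventually.of_forall fun u hu ↦ ?_)
      refine (((integrable_exp_neg_mul_sq (b := u) hu).const_mul
        (u ^ (s - 1) * Real.exp (-u))).congr (Filter.Eventually.of_forall fun t ↦ ?_))
      simp only [Function.uncurry]
      rw [mul_assoc, ← Real.exp_add]
      ring_nf
    · have h2 : IntegrableOn (fun u : ℝ ↦ √π * (Real.exp (-u) * u ^ ((s - 1 / 2) - 1))) (Ioi 0) :=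
        (Real.GammaIntegral_convergent (by linarith)).const_mul _
      refine h2.congr_fun (fun u hu ↦ ?_) measurableSet_Ioi
      simp only [Function.uncurry]
      rw [← hinner u hu]
      refine integral_congr_ae (Filter.Eventually.of_forall fun t ↦ ?_)
      have : 0 < u := hu
      simp only
      rw [Real.norm_of_nonneg (by positivity)]
  rw [← integral_mul_const]
  simp_rw [hpt]
  rw [integral_integral_swap hint, setIntegral_congr_fun measurableSet_Ioi hinner,
    integral_const_mul, Real.Gamma_eq_integral (by linarith)]

theorem integrable_one_add_sq_rpow {s : ℝ} (hs : 1 / 2 < s) :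
    MeasureTheory.Integrable fun t : ℝ ↦ (1 + t ^ 2) ^ (-s) := by
  have := integrable_rpow_neg_one_add_norm_sq (E := ℝ) (μ := MeasureTheory.volume) (r := 2 * s)
    (by simp; linarith)
  refine this.congr (Filter.Eventually.of_forall fun t ↦ ?_)
  simp only [Real.norm_eq_abs, sq_abs]
  congr 1
  ring

theorem hasDerivAt_Gamma_ratio :
    HasDerivAt (fun s : ℝ ↦ √π * Real.Gamma (s - 1 / 2) / Real.Gamma s)
      (-(2 * π * Real.log 2)) 1 := by
  have h1 : HasDerivAt (fun s : ℝ ↦ Real.Gamma (s - 1 / 2))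
      (-√π * (Real.eulerMascheroniConstant + 2 * Real.log 2)) 1 := by
    have h : HasDerivAt Real.Gamma
      (-√π * (Real.eulerMascheroniConstant + 2 * Real.log 2)) ((1 : ℝ) - 1 / 2) := by
      convert Real.hasDerivAt_Gamma_one_half using 1; norm_num
    exact h.comp_sub_const 1 (1 / 2)
  have h2 := (h1.const_mul √π).div Real.hasDerivAt_Gamma_one (by simp)
  rw [show (1 : ℝ) - 1 / 2 = 1 / 2 by norm_num, Real.Gamma_one_half_eq, Real.Gamma_one] at h2
  refine h2.congr_deriv ?_
  have := Real.mul_self_sqrt Real.pi_nonneg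
  linear_combination (-2 * Real.log 2) * this

theorem normSq_add_ofReal (w : ℂ) (t : ℝ) :
    Complex.normSq (w + t) = (w.re + t) ^ 2 + w.im ^ 2 := by
  simp [Complex.normSq_apply]
  ring

theorem normSq_add_ofReal_eq {w : ℂ} (hw : 0 < w.im) (t : ℝ) :
    Complex.normSq (w + t) = w.im ^ 2 * (1 + ((t + w.re) / w.im) ^ 2) := by
  rw [normSq_add_ofReal]
  field_simp
  ring

theorem normSq_rpow_add_ofReal {w : ℂ} (hw : 0 < w.im) (s t : ℝ) :
    Complex.normSq (w + t) ^ (-s) =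
      w.im ^ (-2 * s) * (1 + ((t + w.re) / w.im) ^ 2) ^ (-s) := by
  rw [normSq_add_ofReal_eq hw, Real.mul_rpow (by positivity) (by positivity),
    ← Real.rpow_natCast, ← Real.rpow_mul hw.le]
  norm_num

theorem integrable_normSq_rpow {w : ℂ} (hw : 0 < w.im) {s : ℝ} (hs : 1 / 2 < s) :
    MeasureTheory.Integrable fun t : ℝ ↦ Complex.normSq (w + t) ^ (-s) := by
  simp_rw [normSq_rpow_add_ofReal hw]
  exact (((integrable_one_add_sq_rpow hs).comp_div hw.ne').comp_add_right w.re).const_mul _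

theorem integral_normSq_rpow {w : ℂ} (hw : 0 < w.im) {s : ℝ} (hs : 1 / 2 < s) :
    ∫ t : ℝ, Complex.normSq (w + t) ^ (-s) =
      w.im ^ (1 - 2 * s) * (√π * Real.Gamma (s - 1 / 2) / Real.Gamma s) := by
  simp_rw [normSq_rpow_add_ofReal hw]
  rw [MeasureTheory.integral_const_mul,
    MeasureTheory.integral_add_right_eq_self (fun t : ℝ ↦ (1 + (t / w.im) ^ 2) ^ (-s)) w.re,
    MeasureTheory.Measure.integral_comp_div (fun t : ℝ ↦ (1 + t ^ 2) ^ (-s)),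
    integral_one_add_sq_rpow hs, abs_of_pos hw, smul_eq_mul, ← mul_assoc,
    show 1 - 2 * s = -2 * s + 1 by ring, Real.rpow_add hw, Real.rpow_one]

/-- The difference between a term of the lattice sum and the integral over the unit segment
starting there. -/
noncomputable def bracket (s : ℝ) (w : ℂ) : ℝ :=
  Complex.normSq w ^ (-s) - ∫ t in (0 : ℝ)..1, Complex.normSq (w + t) ^ (-s)

theorem hasDerivAt_normSq_rpow {w : ℂ} (hw : 0 < w.im) (s t : ℝ) :
    HasDerivAt (fun t : ℝ ↦ Complex.normSq (w + t) ^ (-s))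
      (2 * (w.re + t) * (-s) * Complex.normSq (w + t) ^ (-s - 1)) t := by
  simp_rw [normSq_add_ofReal]
  have h : HasDerivAt (fun t : ℝ ↦ (w.re + t) ^ 2 + w.im ^ 2) (2 * (w.re + t)) t := by
    simpa using (((hasDerivAt_id t).const_add w.re).pow 2).add_const (w.im ^ 2)
  exact h.rpow_const (Or.inl (by positivity))

theorem continuous_normSq_rpow {w : ℂ} (hw : 0 < w.im) (s : ℝ) :
    Continuous (fun t : ℝ ↦ Complex.normSq (w + t) ^ (-s)) :=
  continuous_iff_continuousAt.2 fun t ↦ (hasDerivAt_normSq_rpow hw s t).continuousAt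

theorem normSq_le_mul_normSq_add {y : ℝ} (hy : 0 < y) {w : ℂ} (hw : y ≤ w.im) {t : ℝ}
    (ht0 : 0 ≤ t) (ht1 : t ≤ 1) :
    Complex.normSq w ≤ (2 + 2 / y ^ 2) * Complex.normSq (w + t) := by
  have h0 : Complex.normSq w = w.re ^ 2 + w.im ^ 2 := by rw [Complex.normSq_apply]; ring
  rw [normSq_add_ofReal, h0]
  have h1 : 1 ≤ w.im ^ 2 / y ^ 2 := by
    rw [one_le_div (by positivity)]
    gcongr
  have h2 : (2 + 2 / y ^ 2) * ((w.re + t) ^ 2 + w.im ^ 2) =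
      2 * (w.re + t) ^ 2 + 2 * w.im ^ 2 + 2 * (w.im ^ 2 / y ^ 2) +
        2 / y ^ 2 * (w.re + t) ^ 2 := by ring
  rw [h2]
  have h3 : 0 ≤ 2 / y ^ 2 * (w.re + t) ^ 2 := by positivity
  nlinarith [sq_nonneg (w.re + 2 * t)]

theorem norm_deriv_normSq_rpow_le {y : ℝ} (hy : 0 < y) {w : ℂ} (hw : y ≤ w.im) {s : ℝ}
    (hs1 : 1 ≤ s) (hs2 : s ≤ 2) {t : ℝ} (ht0 : 0 ≤ t) (ht1 : t ≤ 1) :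
    ‖2 * (w.re + t) * (-s) * Complex.normSq (w + t) ^ (-s - 1)‖ ≤
      4 * (2 + 2 / y ^ 2) ^ (5 / 2 : ℝ) * Complex.normSq w ^ (-(3 / 2) : ℝ) := by
  set A := 2 + 2 / y ^ 2 with hA
  set N := Complex.normSq (w + t) with hN
  have hA1 : 1 ≤ A := by
    have : 0 ≤ 2 / y ^ 2 := by positivity
    linarith
  have hA0 : 0 < A := by linarith
  have him : 0 < w.im := hy.trans_le hw
  have hNy : 1 / A ≤ N := by
    rw [hN, normSq_add_ofReal]
    have h1 : y ^ 2 ≤ w.im ^ 2 := by gcongr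
    have h2 : 1 ≤ A * y ^ 2 := by
      rw [hA, add_mul, div_mul_cancel₀ _ (by positivity)]
      nlinarith [sq_nonneg y]
    have h3 : 1 / A ≤ y ^ 2 := by
      rw [div_le_iff₀ hA0]; linarith
    nlinarith [sq_nonneg (w.re + t)]
  have hN0 : 0 < N := lt_of_lt_of_le (by positivity) hNy
  have hw0 : 0 < Complex.normSq w := Complex.normSq_pos.2 (by rintro rfl; simp at him)
  have hle := normSq_le_mul_normSq_add hy hw ht0 ht1
  have habs : |w.re + t| ≤ N ^ (1 / 2 : ℝ) := by
    rw [← Real.sqrt_eq_rpow]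
    refine Real.abs_le_sqrt ?_
    rw [hN, normSq_add_ofReal]
    nlinarith [sq_nonneg w.im]
  have e1 : ‖2 * (w.re + t) * (-s) * N ^ (-s - 1)‖ = 2 * s * (|w.re + t| * N ^ (-s - 1)) := by
    rw [Real.norm_eq_abs, abs_mul, abs_mul, abs_mul, abs_neg, abs_of_pos (by linarith : 0 < s),
      abs_of_pos (Real.rpow_pos_of_pos hN0 _), abs_two]
    ring
  rw [e1]
  have e2 : |w.re + t| * N ^ (-s - 1) ≤ N ^ (-(s - 1)) * N ^ (-(3 / 2) : ℝ) := by
    calc _ ≤ N ^ (1 / 2 : ℝ) * N ^ (-s - 1) := by gcongr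
      _ = _ := by rw [← Real.rpow_add hN0, ← Real.rpow_add hN0]; congr 1; ring
  have e3 : N ^ (-(s - 1)) ≤ A := by
    calc N ^ (-(s - 1)) ≤ (1 / A) ^ (-(s - 1)) :=
          Real.rpow_le_rpow_of_nonpos (by positivity) hNy (by linarith)
      _ = A ^ (s - 1) := by rw [one_div, Real.inv_rpow hA0.le, Real.rpow_neg hA0.le, inv_inv]
      _ ≤ A ^ (1 : ℝ) := Real.rpow_le_rpow_of_exponent_le hA1 (by linarith)
      _ = A := Real.rpow_one A
  have e4 : N ^ (-(3 / 2) : ℝ) ≤ A ^ (3 / 2 : ℝ) * Complex.normSq w ^ (-(3 / 2) : ℝ) := by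
    calc N ^ (-(3 / 2) : ℝ) ≤ (Complex.normSq w / A) ^ (-(3 / 2) : ℝ) := by
          refine Real.rpow_le_rpow_of_nonpos (by positivity) ?_ (by norm_num)
          rw [div_le_iff₀ hA0]; linarith
      _ = _ := by
          rw [Real.div_rpow hw0.le hA0.le, Real.rpow_neg hA0.le, div_inv_eq_mul, mul_comm]
  calc 2 * s * (|w.re + t| * N ^ (-s - 1))
      ≤ 2 * 2 * (A * (A ^ (3 / 2 : ℝ) * Complex.normSq w ^ (-(3 / 2) : ℝ))) := by
        have := e2.trans (mul_le_mul e3 e4 (by positivity) hA0.le)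
        have h0 : 0 ≤ |w.re + t| * N ^ (-s - 1) := by positivity
        nlinarith
    _ = _ := by
        rw [show (5 / 2 : ℝ) = 1 + 3 / 2 by norm_num, Real.rpow_add hA0, Real.rpow_one]
        ring

theorem norm_bracket_le {y : ℝ} (hy : 0 < y) {w : ℂ} (hw : y ≤ w.im) {s : ℝ}
    (hs1 : 1 ≤ s) (hs2 : s ≤ 2) :
    ‖bracket s w‖ ≤ 4 * (2 + 2 / y ^ 2) ^ (5 / 2 : ℝ) * Complex.normSq w ^ (-(3 / 2) : ℝ) := by
  set B := 4 * (2 + 2 / y ^ 2) ^ (5 / 2 : ℝ) * Complex.normSq w ^ (-(3 / 2) : ℝ) with hB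
  have him : 0 < w.im := hy.trans_le hw
  have hB0 : 0 ≤ B := by
    have := Complex.normSq_nonneg w
    positivity
  have key {t : ℝ} (ht0 : 0 ≤ t) (ht1 : t ≤ 1) :
      ‖Complex.normSq w ^ (-s) - Complex.normSq (w + t) ^ (-s)‖ ≤ B := by
    have := (convex_Icc (0 : ℝ) 1).norm_image_sub_le_of_norm_hasDerivWithin_le
      (f := fun t : ℝ ↦ Complex.normSq (w + t) ^ (-s)) (C := B)
      (fun t _ ↦ (hasDerivAt_normSq_rpow him s t).hasDerivWithinAt)
      (fun t ht ↦ norm_deriv_normSq_rpow_le hy hw hs1 hs2 ht.1 ht.2)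
      (x := t) (y := 0) ⟨ht0, ht1⟩ ⟨le_rfl, zero_le_one⟩
    simp only [Complex.ofReal_zero, add_zero, zero_sub, norm_neg, Real.norm_of_nonneg ht0] at this
    exact this.trans (mul_le_of_le_one_right hB0 ht1)
  have h1 : bracket s w =
      ∫ t in (0 : ℝ)..1, (Complex.normSq w ^ (-s) - Complex.normSq (w + t) ^ (-s)) := by
    rw [intervalIntegral.integral_sub (by simp)
      ((continuous_normSq_rpow him s).intervalIntegrable _ _)]
    simp [bracket]
  rw [h1]
  refine (intervalIntegral.norm_integral_le_of_norm_le_const (C := B) fun t ht ↦ ?_).trans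
    (by simp)
  rw [Set.uIoc_of_le zero_le_one] at ht
  exact key ht.1.le ht.2

theorem continuous_bracket {w : ℂ} (hw : 0 < w.im) : Continuous (fun s ↦ bracket s w) := by
  have h0 : Complex.normSq w ≠ 0 := by
    rw [Ne, Complex.normSq_eq_zero]
    rintro rfl
    simp at hw
  refine .sub (.rpow continuous_const continuous_neg fun s ↦ Or.inl h0) ?_
  refine intervalIntegral.continuous_parametric_intervalIntegral_of_continuous' ?_ 0 1
  refine Continuous.rpow (by fun_prop) (by fun_prop) fun p ↦ Or.inl ?_
  rw [normSq_add_ofReal]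
  positivity

theorem hasSum_bracket {w : ℂ} (hw : 0 < w.im) {s : ℝ} (hs : 1 / 2 < s)
    (hsum : Summable fun n : ℤ ↦ Complex.normSq (w + n) ^ (-s)) :
    HasSum (fun n : ℤ ↦ bracket s (w + n)) (∑' n : ℤ, Complex.normSq (w + n) ^ (-s) -
      w.im ^ (1 - 2 * s) * (√π * Real.Gamma (s - 1 / 2) / Real.Gamma s)) := by
  rw [← integral_normSq_rpow hw hs]
  refine hsum.hasSum.sub ?_
  convert (integrable_normSq_rpow hw hs).hasSum_intervalIntegral_comp_add_int using 4 with n t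
  push_cast
  ring_nf

open UpperHalfPlane in
theorem summable_normSq_rpow (z : UpperHalfPlane) {s : ℝ} (hs : 1 < s) :
    Summable fun p : ℤ × ℤ ↦ Complex.normSq (p.1 * z + p.2) ^ (-s) := by
  have h1 := (EisensteinSeries.summable_one_div_norm_rpow (k := 2 * s) (by linarith)).mul_left
    (EisensteinSeries.r z ^ (-(2 * s)))
  rw [← (finTwoArrowEquiv _).symm.summable_iff] at h1
  refine h1.of_nonneg_of_le (fun p ↦ Real.rpow_nonneg (Complex.normSq_nonneg _) _) fun p ↦ ?_
  have h2 := EisensteinSeries.summand_bound z (k := 2 * s) (by linarith) ![p.1, p.2]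
  refine le_trans (le_of_eq ?_) h2
  simp only [Matrix.cons_val_zero, Matrix.cons_val_one]
  rw [Complex.normSq_eq_norm_sq, ← Real.rpow_natCast, ← Real.rpow_mul (norm_nonneg _)]
  congr 1
  push_cast
  ring

theorem summable_normSq_rpow_nat (z : UpperHalfPlane) {s : ℝ} (hs : 1 < s) :
    Summable fun p : ℕ × ℤ ↦ Complex.normSq (((p.1 : ℂ) + 1) * z + p.2) ^ (-s) := by
  have hinj : Function.Injective fun p : ℕ × ℤ ↦ ((p.1 : ℤ) + 1, p.2) := by
    rintro ⟨a, b⟩ ⟨c, d⟩ h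
    simpa using h
  refine ((summable_normSq_rpow z hs).comp_injective hinj).congr fun p ↦ ?_
  simp

theorem bracket_bound (z : UpperHalfPlane) : ∃ B : ℝ, ∀ s : ℝ, 1 ≤ s → s ≤ 2 → ∀ p : ℕ × ℤ,
    ‖bracket s (((p.1 : ℂ) + 1) * z + p.2)‖ ≤
      B * Complex.normSq (((p.1 : ℂ) + 1) * z + p.2) ^ (-(3 / 2) : ℝ) := by
  refine ⟨_, fun s h1 h2 p ↦ norm_bracket_le z.im_pos (w := ((p.1 : ℂ) + 1) * z + p.2) ?_ h1 h2⟩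
  have := z.im_pos
  have hp : (0 : ℝ) ≤ p.1 := by positivity
  simp [UpperHalfPlane.coe_im]
  nlinarith

theorem summable_bracket (z : UpperHalfPlane) {s : ℝ} (h1 : 1 ≤ s) (h2 : s ≤ 2) :
    Summable fun p : ℕ × ℤ ↦ bracket s (((p.1 : ℂ) + 1) * z + p.2) := by
  obtain ⟨B, hB⟩ := bracket_bound z
  exact ((summable_normSq_rpow_nat z (s := 3 / 2) (by norm_num)).mul_left B).of_norm_bounded
    (hB s h1 h2)

theorem tendsto_tsum_bracket (z : UpperHalfPlane) :
    Filter.Tendsto (fun s ↦ ∑' p : ℕ × ℤ, bracket s (((p.1 : ℂ) + 1) * z + p.2))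
      (nhdsWithin 1 (Set.Ioi 1)) (nhds (∑' p : ℕ × ℤ, bracket 1 (((p.1 : ℂ) + 1) * z + p.2))) := by
  obtain ⟨B, hB⟩ := bracket_bound z
  refine tendsto_tsum_of_dominated_convergence
    ((summable_normSq_rpow_nat z (s := 3 / 2) (by norm_num)).mul_left B) (fun p ↦ ?_) ?_
  · refine ((continuous_bracket ?_).tendsto 1).mono_left nhdsWithin_le_nhds
    have := z.im_pos
    simp [UpperHalfPlane.coe_im]
    positivity
  · filter_upwards [Ioc_mem_nhdsGT (show (1 : ℝ) < 2 by norm_num)] with s hs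
    exact hB s hs.1.le hs.2

/-- The real zeta series. -/
noncomputable def zetaSum (x : ℝ) : ℝ := ∑' n : ℕ, ((n : ℝ) + 1) ^ (-x)

theorem summable_zetaSum {x : ℝ} (hx : 1 < x) : Summable fun n : ℕ ↦ ((n : ℝ) + 1) ^ (-x) := by
  have := (summable_nat_add_iff 1).2 (Real.summable_nat_rpow (p := -x) |>.2 (by linarith))
  exact_mod_cast this

theorem riemannZeta_ofReal {x : ℝ} (hx : 1 < x) : riemannZeta x = zetaSum x := by
  rw [zeta_eq_tsum_one_div_nat_add_one_cpow (by simpa using hx), zetaSum, Complex.ofReal_tsum]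
  congr 1 with n
  rw [Complex.ofReal_cpow (by positivity)]
  push_cast
  rw [Complex.cpow_neg, one_div]

theorem tendsto_zetaSum_sub :
    Filter.Tendsto (fun s : ℝ ↦ zetaSum s - 1 / (s - 1)) (nhdsWithin 1 (Set.Ioi 1))
      (nhds Real.eulerMascheroniConstant) := by
  have h := (Complex.continuous_re.tendsto _).comp
    ZetaAsymptotics.tendsto_riemannZeta_sub_one_div_nhds_right
  refine h.congr' ?_
  filter_upwards [self_mem_nhdsWithin] with s hs
  rw [Function.comp_apply, riemannZeta_ofReal hs]
  norm_cast

theorem tsum_int_mul_eq (z : UpperHalfPlane) {s : ℝ} (hs : 1 < s) :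
    ∑' p : ℤ × ℤ, Complex.normSq (p.1 * z + p.2) ^ (-s) =
      2 * zetaSum (2 * s) +
        2 * ∑' p : ℕ × ℤ, Complex.normSq (((p.1 : ℂ) + 1) * z + p.2) ^ (-s) := by
  have hsum := summable_normSq_rpow z hs
  have hsum' := summable_normSq_rpow_nat z hs
  rw [hsum.tsum_prod, hsum'.tsum_prod]
  have heven : Function.Even
      fun m : ℤ ↦ ∑' n : ℤ, Complex.normSq ((m : ℂ) * z + n) ^ (-s) := by
    intro m
    simp only
    rw [← (Equiv.neg ℤ).tsum_eq]
    congr 1 with n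
    rw [← Complex.normSq_neg]
    congr 2
    simp
    ring
  rw [tsum_int_eq_zero_add_two_mul_tsum_pnat heven hsum.prod]
  congr 1
  · have heven' : Function.Even
        fun n : ℤ ↦ Complex.normSq (((0 : ℤ) : ℂ) * z + n) ^ (-s) := by
      intro n
      simp
    have hfib := hsum.prod_factor 0
    rw [tsum_int_eq_zero_add_two_mul_tsum_pnat heven' hfib]
    have h0 := tsum_pnat_eq_tsum_succ
      (f := fun n : ℕ ↦ Complex.normSq (((0 : ℤ) : ℂ) * z + ((n : ℤ) : ℂ)) ^ (-s))
    have hz : (0 : ℝ) ^ (-s) = 0 := Real.zero_rpow (by linarith)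
    simp only [Int.cast_natCast] at h0 ⊢
    rw [h0]
    simp only [Int.cast_zero, zero_mul, zero_add, add_zero, map_zero, hz, zetaSum]
    rw [two_nsmul, two_mul]
    suffices h : ∀ n : ℕ, Complex.normSq ((n + 1 : ℕ) : ℂ) ^ (-s) =
        ((n : ℝ) + 1) ^ (-(2 * s)) by simp only [h]
    intro n
    rw [← Complex.ofReal_natCast, Complex.normSq_ofReal, ← pow_two, ← Real.rpow_natCast,
      ← Real.rpow_mul (by positivity)]
    push_cast
    ring_nf
  · have h0 := tsum_pnat_eq_tsum_succ
      (f := fun m : ℕ ↦ ∑' n : ℤ, Complex.normSq (((m : ℤ) : ℂ) * z + n) ^ (-s))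
    simp only [Int.cast_natCast] at h0 ⊢
    rw [h0]
    push_cast
    rw [two_nsmul, two_mul]

theorem tsum_lattice_eq (z : UpperHalfPlane) {s : ℝ} (hs : 1 < s) (hs2 : s ≤ 2) :
    ∑' p : ℤ × ℤ, Complex.normSq (p.1 * z + p.2) ^ (-s) =
      2 * zetaSum (2 * s) + 2 * ∑' p : ℕ × ℤ, bracket s (((p.1 : ℂ) + 1) * z + p.2) +
        2 * (z.im ^ (1 - 2 * s) * (√π * Real.Gamma (s - 1 / 2) / Real.Gamma s)) *
          zetaSum (2 * s - 1) := by
  rw [tsum_int_mul_eq z hs]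
  have hsum := summable_normSq_rpow_nat z hs
  have hbr := summable_bracket z hs.le hs2
  rw [hbr.tsum_prod, hsum.tsum_prod]
  have him (m : ℕ) : (((m : ℂ) + 1) * z).im = (m + 1) * z.im := by
    simp [UpperHalfPlane.coe_im]
  have hpos (m : ℕ) : 0 < (((m : ℂ) + 1) * z).im := by
    have := z.im_pos
    rw [him]; positivity
  have hfib (m : ℕ) := (hasSum_bracket (hpos m) (s := s) (by linarith)
    (hsum.prod_factor m)).tsum_eq
  have hz := (summable_zetaSum (x := 2 * s - 1) (by linarith)).mul_left
    (z.im ^ (1 - 2 * s) * (√π * Real.Gamma (s - 1 / 2) / Real.Gamma s))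
  have hfac (m : ℕ) : (((m : ℂ) + 1) * z).im ^ (1 - 2 * s) *
      (√π * Real.Gamma (s - 1 / 2) / Real.Gamma s) =
      z.im ^ (1 - 2 * s) * (√π * Real.Gamma (s - 1 / 2) / Real.Gamma s) *
        ((m : ℝ) + 1) ^ (-(2 * s - 1)) := by
    rw [him, Real.mul_rpow (by positivity) z.im_pos.le, neg_sub]
    ring
  simp only [hfib, hfac]
  rw [hsum.prod.tsum_sub hz, tsum_mul_left, ← zetaSum]
  ring

theorem summable_normSq_rpow_neg_one (w : ℂ) :
    Summable fun n : ℤ ↦ Complex.normSq (w + n) ^ (-1 : ℝ) := by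
  have := (EisensteinSeries.linear_right_summable w 1 (k := 2) le_rfl).norm
  refine this.congr fun n ↦ ?_
  rw [Real.rpow_neg_one, norm_inv, norm_zpow, Complex.normSq_eq_norm_sq]
  simp

theorem im_one_div_eq (w : ℂ) : (1 / w).im = -w.im * Complex.normSq w ^ (-1 : ℝ) := by
  rw [one_div, Complex.inv_im, Real.rpow_neg_one, div_eq_mul_inv]

theorem tsum_normSq_rpow_neg_one (z : UpperHalfPlane) :
    ∑' n : ℤ, Complex.normSq (z + n) ^ (-1 : ℝ) =
      π / z.im + 2 * π / z.im * ∑' k : ℕ, (Complex.exp (2 * π * Complex.I * z) ^ (k + 1)).re := by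
  have hq := UpperHalfPlane.norm_exp_two_pi_I_lt_one z
  have hgeo := summable_geometric_of_norm_lt_one hq
  have hz : (z : ℂ) ∈ Complex.integerComplement := UpperHalfPlane.coe_mem_integerComplement z
  have h1 := (summable_cotTerm hz).hasSum
  have h1' : ∑' n, cotTerm (z : ℂ) n = π * Complex.cot (π * z) - 1 / z :=
    (cot_series_rep' hz).symm
  rw [h1', pi_mul_cot_pi_q_exp] at h1
  have h2 := Complex.hasSum_im h1
  have hsum := summable_normSq_rpow_neg_one z
  have h3 := tsum_int_eq_zero_add_tsum_pnat hsum
  rw [tsum_pnat_eq_tsum_succ (f := fun n : ℕ ↦ Complex.normSq (z + (n : ℤ)) ^ (-1 : ℝ)),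
    tsum_pnat_eq_tsum_succ (f := fun n : ℕ ↦ Complex.normSq (z + ((-(n : ℤ) : ℤ) : ℂ)) ^ (-1 : ℝ))]
    at h3
  have hs1 : Summable fun n : ℕ ↦ Complex.normSq (z + ((n + 1 : ℕ) : ℤ)) ^ (-1 : ℝ) :=
    hsum.comp_injective (i := fun n : ℕ ↦ ((n + 1 : ℕ) : ℤ)) fun a b h ↦ by simpa using h
  have hs2 : Summable fun n : ℕ ↦ Complex.normSq (z + ((-((n + 1 : ℕ) : ℤ) : ℤ) : ℂ)) ^ (-1 : ℝ) :=
    hsum.comp_injective (i := fun n : ℕ ↦ -((n + 1 : ℕ) : ℤ)) fun a b h ↦ by simpa using h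
  rw [add_assoc, ← hs1.tsum_add hs2] at h3
  have h4 : HasSum (fun n : ℕ ↦ (cotTerm (z : ℂ) n).im)
      (-z.im * ∑' n : ℕ, (Complex.normSq (z + ((n + 1 : ℕ) : ℤ)) ^ (-1 : ℝ) +
        Complex.normSq (z + ((-((n + 1 : ℕ) : ℤ) : ℤ) : ℂ)) ^ (-1 : ℝ))) := by
    refine ((hs1.add hs2).hasSum.mul_left (-z.im)).congr_fun ?_
    intro n
    rw [cotTerm, Complex.add_im, im_one_div_eq, im_one_div_eq]
    have e1 : (z : ℂ) - (n + 1) = z + ((-((n + 1 : ℕ) : ℤ) : ℤ) : ℂ) := by push_cast; ring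
    have e2 : (z : ℂ) + (n + 1) = z + (((n + 1 : ℕ) : ℤ) : ℂ) := by push_cast; ring
    rw [e1, e2]
    simp
    ring
  have h5 := h2.unique h4
  have hre := Complex.hasSum_re ((summable_nat_add_iff 1).2 hgeo).hasSum
  have h6 := hgeo.tsum_eq_zero_add
  rw [hre.tsum_eq]
  rw [h6, Complex.sub_im, im_one_div_eq] at h5
  have hy := z.im_pos
  generalize (∑' k : ℕ, Complex.exp (2 * π * Complex.I * z) ^ (k + 1)) = S at *
  rw [h3]
  generalize (∑' n : ℕ, (Complex.normSq (z + ((n + 1 : ℕ) : ℤ)) ^ (-1 : ℝ) +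
        Complex.normSq (z + ((-((n + 1 : ℕ) : ℤ) : ℤ) : ℂ)) ^ (-1 : ℝ))) = T at *
  simp at h5 ⊢
  field_simp
  linarith

theorem tsum_bracket_one (z : UpperHalfPlane) (m : ℕ) :
    HasSum (fun n : ℤ ↦ bracket 1 (((m : ℂ) + 1) * z + n)) (2 * π / z.im *
      ∑' k : ℕ, ((Complex.exp (2 * π * Complex.I * z) ^ (k + 1)) ^ (m + 1) / (m + 1)).re) := by
  have hm : (0 : ℝ) < m + 1 := by positivity
  have hy := z.im_pos
  let w : UpperHalfPlane := ⟨((m : ℂ) + 1) * z, by simp; positivity⟩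
  have hw : (w : ℂ) = ((m : ℂ) + 1) * z := rfl
  have hwim : w.im = (m + 1) * z.im := by
    rw [← UpperHalfPlane.coe_im, hw]; simp
  have h := hasSum_bracket (w := w) w.im_pos (s := 1) (by norm_num)
    (summable_normSq_rpow_neg_one w)
  rw [tsum_normSq_rpow_neg_one] at h
  rw [← hw]
  convert h using 1
  have e1 : (1 : ℝ) - 1 / 2 = 1 / 2 := by norm_num
  have e2 : (1 : ℝ) - 2 * 1 = -1 := by norm_num
  rw [e1, e2, Real.Gamma_one_half_eq, Real.Gamma_one, div_one, Real.mul_self_sqrt Real.pi_pos.le,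
    Real.rpow_neg_one, UpperHalfPlane.coe_im, hwim, hw, ← tsum_mul_left]
  have e3 (k : ℕ) : 2 * π / z.im *
      ((Complex.exp (2 * π * Complex.I * z) ^ (k + 1)) ^ (m + 1) / (m + 1)).re =
      2 * π / ((m + 1) * z.im) *
        (Complex.exp (2 * π * Complex.I * (((m : ℂ) + 1) * z)) ^ (k + 1)).re := by
    have : ((m : ℂ) + 1) = ((m + 1 : ℝ) : ℂ) := by push_cast; ring
    rw [this, Complex.div_ofReal_re, ← pow_mul, ← Complex.exp_nat_mul, ← Complex.exp_nat_mul]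
    have : ((((k + 1) * (m + 1) : ℕ) : ℂ) * (2 * π * Complex.I * z)) =
      ((k + 1 : ℕ) : ℂ) * (2 * π * Complex.I * (((m + 1 : ℝ) : ℂ) * z)) := by push_cast; ring
    rw [this]
    field_simp
  simp_rw [e3]
  rw [tsum_mul_left]
  field_simp
  ring

theorem summable_pow_pow_div {q : ℂ} (hq : ‖q‖ < 1) :
    Summable fun p : ℕ × ℕ ↦ ((q ^ (p.1 + 1)) ^ (p.2 + 1) / ((p.2 : ℂ) + 1)).re := by
  have hg := summable_geometric_of_lt_one (norm_nonneg q) hq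
  refine (hg.mul_of_nonneg hg (fun _ ↦ by positivity) (fun _ ↦ by positivity)).of_norm_bounded
    fun p ↦ ?_
  have h1 : (1 : ℝ) ≤ ‖(p.2 : ℂ) + 1‖ := by
    have : (p.2 : ℂ) + 1 = ((p.2 + 1 : ℕ) : ℂ) := by push_cast; ring
    rw [this, Complex.norm_natCast]
    push_cast
    linarith [Nat.cast_nonneg (α := ℝ) p.2]
  refine (Complex.abs_re_le_norm _).trans ?_
  rw [norm_div, norm_pow, norm_pow, ← pow_mul, ← pow_add]
  refine (div_le_self (by positivity) h1).trans (pow_le_pow_of_le_one (norm_nonneg q) hq.le ?_)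
  nlinarith

theorem tsum_pow_div_re {x : ℂ} (hx : ‖x‖ < 1) :
    ∑' m : ℕ, (x ^ (m + 1) / ((m : ℂ) + 1)).re = -Real.log ‖1 - x‖ := by
  have h := Complex.hasSum_taylorSeries_neg_log hx
  rw [← hasSum_nat_add_iff' 1] at h
  have h2 := Complex.hasSum_re h
  simp only [Finset.range_one, Finset.sum_singleton, pow_zero, Nat.cast_zero, div_zero, sub_zero,
    Complex.neg_re, Complex.log_re, Nat.cast_add, Nat.cast_one] at h2
  exact h2.tsum_eq

theorem norm_pow_succ_lt_one {q : ℂ} (hq : ‖q‖ < 1) (k : ℕ) : ‖q ^ (k + 1)‖ < 1 := by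
  rw [norm_pow]
  exact pow_lt_one₀ (norm_nonneg _) hq (by simp)

theorem tsum_bracket_one_eq (z : UpperHalfPlane) :
    ∑' p : ℕ × ℤ, bracket 1 (((p.1 : ℂ) + 1) * z + p.2) = -(2 * π / z.im) *
      ∑' k : ℕ, Real.log ‖1 - Complex.exp (2 * π * Complex.I * z) ^ (k + 1)‖ := by
  have hq := UpperHalfPlane.norm_exp_two_pi_I_lt_one z
  rw [(summable_bracket z le_rfl one_le_two).tsum_prod]
  simp only [(tsum_bracket_one z _).tsum_eq]
  rw [tsum_mul_left, neg_mul, ← mul_neg, ← tsum_neg]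
  congr 1
  have := (summable_pow_pow_div hq).tsum_comm
    (f := fun k m : ℕ ↦ (((Complex.exp (2 * π * Complex.I * z)) ^ (k + 1)) ^ (m + 1) /
      ((m : ℂ) + 1)).re)
  rw [this]
  exact tsum_congr fun k ↦ tsum_pow_div_re (norm_pow_succ_lt_one hq k)

theorem summable_log_norm_one_sub_pow {q : ℂ} (hq : ‖q‖ < 1) :
    Summable fun k : ℕ ↦ Real.log ‖1 - q ^ (k + 1)‖ := by
  have := (summable_pow_pow_div hq).prod
  refine this.neg.congr fun k ↦ ?_
  simp only
  rw [tsum_pow_div_re (norm_pow_succ_lt_one hq k), neg_neg]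

theorem log_norm_eta (z : UpperHalfPlane) : Real.log ‖ModularForm.eta z‖ =
    -(π * z.im / 12) +
      ∑' k : ℕ, Real.log ‖1 - Complex.exp (2 * π * Complex.I * z) ^ (k + 1)‖ := by
  have hq := UpperHalfPlane.norm_exp_two_pi_I_lt_one z
  have hm := ModularForm.multipliable_one_sub_pow hq
  have hne (k : ℕ) : 0 < ‖1 - Complex.exp (2 * π * Complex.I * z) ^ (k + 1)‖ := by
    refine norm_pos_iff.2 fun h ↦ ?_
    have := norm_pow_succ_lt_one hq k
    rw [← sub_eq_zero.1 h, norm_one] at this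
    exact this.false
  have h1 : ‖∏' k : ℕ, (1 - ModularForm.eta_q k z)‖ =
      Real.exp (∑' k : ℕ, Real.log ‖1 - Complex.exp (2 * π * Complex.I * z) ^ (k + 1)‖) := by
    rw [Real.rexp_tsum_eq_tprod hne (summable_log_norm_one_sub_pow hq), ← hm.norm_tprod]
    simp only [ModularForm.eta_q_eq_pow]
  rw [ModularForm.eta, norm_mul, h1, Function.Periodic.norm_qParam, ← Real.exp_add, Real.log_exp]
  congr 1
  rw [UpperHalfPlane.coe_im]
  ring

section Analysis

open Filter Topology

theorem tendsto_zetaSum_two_mul :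
    Tendsto (fun s : ℝ ↦ zetaSum (2 * s)) (𝓝[>] 1) (𝓝 (π ^ 2 / 6)) := by
  have h1 : Tendsto (fun s : ℝ ↦ (riemannZeta ((2 * s : ℝ) : ℂ)).re) (𝓝[>] 1) (𝓝 (π ^ 2 / 6)) := by
    have hc : ContinuousAt riemannZeta ((2 * 1 : ℝ) : ℂ) :=
      (differentiableAt_riemannZeta (by norm_num)).continuousAt
    have h := (Complex.continuous_re.continuousAt.comp hc).tendsto.comp
      (show Tendsto (fun s : ℝ ↦ ((2 * s : ℝ) : ℂ)) (𝓝[>] 1) (𝓝 ((2 * 1 : ℝ) : ℂ)) from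
        ((by fun_prop : Continuous fun s : ℝ ↦ ((2 * s : ℝ) : ℂ)).tendsto 1).mono_left
          nhdsWithin_le_nhds)
    have e : (riemannZeta ((2 * 1 : ℝ) : ℂ)).re = π ^ 2 / 6 := by
      norm_num [riemannZeta_two]
      norm_cast
    simpa only [Function.comp_def, e] using h
  refine h1.congr' ?_
  filter_upwards [self_mem_nhdsWithin] with s hs
  rw [riemannZeta_ofReal (by linarith [Set.mem_Ioi.1 hs]), Complex.ofReal_re]

theorem hasDerivAt_mainFactor {y : ℝ} (hy : 0 < y) :
    HasDerivAt (fun s : ℝ ↦ y ^ (1 - 2 * s) * (√π * Real.Gamma (s - 1 / 2) / Real.Gamma s))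
      (-(2 * π / y) * (Real.log y + Real.log 2)) 1 := by
  have h1 : HasDerivAt (fun s : ℝ ↦ y ^ (1 - 2 * s))
      (Real.log y * (-2) * y ^ (1 - 2 * (1 : ℝ))) 1 := by
    have : HasDerivAt (fun s : ℝ ↦ 1 - 2 * s) (-2) 1 := by
      simpa using ((hasDerivAt_id (1 : ℝ)).const_mul 2).const_sub 1
    exact this.const_rpow hy
  refine (h1.mul hasDerivAt_Gamma_ratio).congr_deriv ?_
  have e1 : (1 : ℝ) - 1 / 2 = 1 / 2 := by norm_num
  have e2 : (1 : ℝ) - 2 * 1 = -1 := by norm_num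
  rw [e1, e2, Real.Gamma_one_half_eq, Real.Gamma_one, div_one, Real.mul_self_sqrt Real.pi_pos.le,
    Real.rpow_neg_one]
  field_simp
  ring

theorem tendsto_mainTerm {y : ℝ} (hy : 0 < y) :
    Tendsto (fun s : ℝ ↦ 2 * (y ^ (1 - 2 * s) * (√π * Real.Gamma (s - 1 / 2) / Real.Gamma s)) *
      zetaSum (2 * s - 1) - π / (y * (s - 1))) (𝓝[>] 1)
      (𝓝 (2 * (π / y) * Real.eulerMascheroniConstant +
        -(2 * π / y) * (Real.log y + Real.log 2))) := by
  have hd := hasDerivAt_mainFactor hy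
  set F := fun s : ℝ ↦ y ^ (1 - 2 * s) * (√π * Real.Gamma (s - 1 / 2) / Real.Gamma s) with hF
  have hF1 : F 1 = π / y := by
    have e1 : (1 : ℝ) - 1 / 2 = 1 / 2 := by norm_num
    have e2 : (1 : ℝ) - 2 * 1 = -1 := by norm_num
    simp only [hF]
    rw [e1, e2, Real.Gamma_one_half_eq, Real.Gamma_one, div_one, Real.mul_self_sqrt Real.pi_pos.le,
      Real.rpow_neg_one]
    field_simp
  have hslope := hd.tendsto_slope.mono_left
    (nhdsWithin_mono 1 (fun s (hs : 1 < s) ↦ ne_of_gt hs))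
  have hFt : Tendsto F (𝓝[>] 1) (𝓝 (π / y)) :=
    hF1 ▸ hd.continuousAt.tendsto.mono_left nhdsWithin_le_nhds
  have hz : Tendsto (fun s : ℝ ↦ zetaSum (2 * s - 1) - 1 / (2 * s - 1 - 1)) (𝓝[>] 1)
      (𝓝 Real.eulerMascheroniConstant) := by
    refine tendsto_zetaSum_sub.comp (f := fun s : ℝ ↦ 2 * s - 1) ?_
    refine tendsto_nhdsWithin_iff.2 ⟨?_, ?_⟩
    · have : Tendsto (fun s : ℝ ↦ 2 * s - 1) (𝓝 1) (𝓝 (2 * 1 - 1)) :=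
        (by fun_prop : Continuous fun s : ℝ ↦ 2 * s - 1).tendsto 1
      norm_num at this
      exact this.mono_left nhdsWithin_le_nhds
    · filter_upwards [self_mem_nhdsWithin] with s hs
      simp only [Set.mem_Ioi] at hs ⊢
      linarith
  refine (((hFt.const_mul 2).mul hz).add hslope).congr' ?_
  filter_upwards [self_mem_nhdsWithin] with s hs
  have hs' : s - 1 ≠ 0 := sub_ne_zero.2 (ne_of_gt hs)
  have hs2 : 2 * s - 1 - 1 = 2 * (s - 1) := by ring
  change _ = 2 * F s * zetaSum (2 * s - 1) - _
  rw [slope_def_field, hF1, hs2]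
  field_simp
  ring

/-- The first Kronecker limit formula. -/
theorem tendsto_lattice_sub (z : UpperHalfPlane) :
    Tendsto (fun s : ℝ ↦ ∑' p : ℤ × ℤ, Complex.normSq (p.1 * z + p.2) ^ (-s) -
      π / (z.im * (s - 1))) (𝓝[>] 1)
      (𝓝 (π / z.im * (2 * Real.eulerMascheroniConstant - 2 * Real.log 2 - 2 * Real.log z.im) -
        4 * π / z.im * Real.log ‖ModularForm.eta z‖)) := by
  have h := ((tendsto_zetaSum_two_mul.const_mul 2).add ((tendsto_tsum_bracket z).const_mul 2)).add
    (tendsto_mainTerm z.im_pos)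
  have hy := z.im_pos
  convert h.congr' ?_ using 2
  · rw [log_norm_eta, tsum_bracket_one_eq]
    field_simp
    ring
  · filter_upwards [Ioc_mem_nhdsGT (show (1 : ℝ) < 2 by norm_num)] with s hs
    rw [tsum_lattice_eq z hs.1 hs.2]
    ring

/-- The second-order Taylor remainder of `(k + 1 + a) ^ (-s)`. -/
noncomputable def hurwitzTerm (a : ℝ) (k : ℕ) (s : ℂ) : ℂ :=
  (((k + 1 + a : ℝ) : ℂ)) ^ (-s) - ((k + 1 : ℝ) : ℂ) ^ (-s) +
    a * s * ((k + 1 : ℝ) : ℂ) ^ (-s - 1)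

theorem hasDerivAt_ofReal_add_cpow {x : ℝ} (hx : 0 < x) {t : ℝ} (ht : 0 ≤ t) (c : ℂ) :
    HasDerivAt (fun t : ℝ ↦ ((x + t : ℝ) : ℂ) ^ c) (c * ((x + t : ℝ) : ℂ) ^ (c - 1)) t := by
  have h1 : HasDerivAt (fun z : ℂ ↦ (x : ℂ) + z) 1 t := (hasDerivAt_id _).const_add _
  have h2 := h1.cpow_const (c := c) (Or.inl (by
    rw [← Complex.ofReal_add, Complex.ofReal_re]; positivity))
  simpa using h2.comp_ofReal

theorem norm_ofReal_add_cpow_le {x : ℝ} (hx : 1 ≤ x) {t : ℝ} (ht : 0 ≤ t) {c : ℂ} {r : ℝ}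
    (hc : c.re ≤ r) (hr : r ≤ 0) : ‖((x + t : ℝ) : ℂ) ^ c‖ ≤ x ^ r := by
  rw [Complex.norm_cpow_eq_rpow_re_of_pos (by positivity)]
  exact (Real.rpow_le_rpow_of_exponent_le (by linarith) hc).trans
    (Real.rpow_le_rpow_of_nonpos (by linarith) (by linarith) hr)

theorem norm_sub_cpow_le {x : ℝ} (hx : 1 ≤ x) {t : ℝ} (ht : 0 ≤ t) (ht1 : t ≤ 1) {c : ℂ} {r : ℝ}
    (hc : c.re - 1 ≤ r) (hr : r ≤ 0) :
    ‖((x + t : ℝ) : ℂ) ^ c - (x : ℂ) ^ c‖ ≤ ‖c‖ * x ^ r := by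
  have h := (convex_Icc (0 : ℝ) 1).norm_image_sub_le_of_norm_hasDerivWithin_le
    (f := fun t : ℝ ↦ ((x + t : ℝ) : ℂ) ^ c)
    (f' := fun t : ℝ ↦ c * ((x + t : ℝ) : ℂ) ^ (c - 1)) (C := ‖c‖ * x ^ r) (x := 0) (y := t)
    (fun u hu ↦ (hasDerivAt_ofReal_add_cpow (by linarith) hu.1 c).hasDerivWithinAt)
    (fun u hu ↦ by
      rw [norm_mul]
      exact mul_le_mul_of_nonneg_left
        (norm_ofReal_add_cpow_le hx hu.1 (by simpa using hc) hr) (norm_nonneg _))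
    (Set.left_mem_Icc.2 zero_le_one) ⟨ht, ht1⟩
  simp only [add_zero, sub_zero] at h
  refine h.trans (mul_le_of_le_one_right (by positivity) ?_)
  rwa [Real.norm_of_nonneg ht]

theorem norm_hurwitzTerm_le {a : ℝ} (ha : 0 ≤ a) (ha1 : a ≤ 1) (k : ℕ) {s : ℂ}
    (hs : -(1 / 2) ≤ s.re) (hs3 : ‖s‖ ≤ 3) :
    ‖hurwitzTerm a k s‖ ≤ 12 * ((k : ℝ) + 1) ^ (-(3 / 2) : ℝ) := by
  have hx : (1 : ℝ) ≤ k + 1 := by linarith [Nat.cast_nonneg (α := ℝ) k]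
  set x : ℝ := k + 1 with hxdef
  have hxr : (0 : ℝ) < x ^ (-(3 / 2) : ℝ) := by positivity
  have h := (convex_Icc (0 : ℝ) 1).norm_image_sub_le_of_norm_hasDerivWithin_le
    (f := fun t : ℝ ↦ ((x + t : ℝ) : ℂ) ^ (-s) + t * s * (x : ℂ) ^ (-s - 1))
    (f' := fun t : ℝ ↦ -s * ((x + t : ℝ) : ℂ) ^ (-s - 1) + s * (x : ℂ) ^ (-s - 1))
    (C := 12 * x ^ (-(3 / 2) : ℝ)) (x := 0) (y := a)
    (fun u hu ↦ by
      have h1 := hasDerivAt_ofReal_add_cpow (x := x) (by linarith) hu.1 (-s)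
      have h2 : HasDerivAt (fun t : ℝ ↦ (t : ℂ) * s * (x : ℂ) ^ (-s - 1))
          (s * (x : ℂ) ^ (-s - 1)) u := by
        simpa using ((hasDerivAt_id u).ofReal_comp.mul_const s).mul_const ((x : ℂ) ^ (-s - 1))
      exact (h1.add h2).hasDerivWithinAt)
    (fun u hu ↦ by
      have h1 := norm_sub_cpow_le (x := x) hx hu.1 hu.2 (c := -s - 1) (r := -(3 / 2))
        (by simp; linarith) (by norm_num)
      have h2 : -s * ((x + u : ℝ) : ℂ) ^ (-s - 1) + s * (x : ℂ) ^ (-s - 1) =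
        -s * (((x + u : ℝ) : ℂ) ^ (-s - 1) - (x : ℂ) ^ (-s - 1)) := by ring
      rw [h2, norm_mul, norm_neg]
      have h3 : ‖-s - 1‖ ≤ 4 := by
        rw [show -s - 1 = -(s + 1) by ring, norm_neg]
        refine (norm_add_le _ _).trans ?_
        rw [norm_one]; linarith
      calc ‖s‖ * _ ≤ 3 * (4 * x ^ (-(3 / 2) : ℝ)) := by gcongr; exact h1.trans (by gcongr)
        _ = _ := by ring)
    (Set.left_mem_Icc.2 zero_le_one) ⟨ha, ha1⟩
  have e : hurwitzTerm a k s = ((x + a : ℝ) : ℂ) ^ (-s) + a * s * (x : ℂ) ^ (-s - 1) -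
      (((x + 0 : ℝ) : ℂ) ^ (-s) + ((0 : ℝ) : ℂ) * s * (x : ℂ) ^ (-s - 1)) := by
    simp [hurwitzTerm, hxdef]
    ring
  rw [e]
  refine h.trans (mul_le_of_le_one_right (by positivity) ?_)
  rwa [sub_zero, Real.norm_of_nonneg ha]

theorem hasDerivAt_ofReal_cpow_neg {x : ℝ} (hx : 0 < x) (b s : ℂ) :
    HasDerivAt (fun s : ℂ ↦ (x : ℂ) ^ (-s - b)) (-(Real.log x * (x : ℂ) ^ (-s - b))) s := by
  have h1 : HasDerivAt (fun s : ℂ ↦ -s - b) (-1) s := by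
    simpa using (hasDerivAt_id s).neg.sub_const b
  have h2 := h1.const_cpow (c := (x : ℂ)) (Or.inl (by exact_mod_cast hx.ne'))
  refine h2.congr_deriv ?_
  rw [← Complex.ofReal_log hx.le]
  ring

theorem hasDerivAt_hurwitzTerm {a : ℝ} (ha : 0 ≤ a) (k : ℕ) (s : ℂ) :
    HasDerivAt (hurwitzTerm a k) (-(Real.log (k + 1 + a) * (((k + 1 + a : ℝ) : ℂ)) ^ (-s)) +
      Real.log (k + 1) * ((k + 1 : ℝ) : ℂ) ^ (-s) + (a * ((k + 1 : ℝ) : ℂ) ^ (-s - 1) -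
      a * s * (Real.log (k + 1) * ((k + 1 : ℝ) : ℂ) ^ (-s - 1)))) s := by
  have h1 := hasDerivAt_ofReal_cpow_neg (x := k + 1 + a) (by positivity) 0 s
  have h2 := hasDerivAt_ofReal_cpow_neg (x := k + 1) (by positivity) 0 s
  have h3 := hasDerivAt_ofReal_cpow_neg (x := k + 1) (by positivity) 1 s
  have h4 := ((hasDerivAt_id s).const_mul (a : ℂ)).mul h3
  simp only [sub_zero] at h1 h2
  refine ((h1.sub h2).add h4).congr_deriv ?_
  simp
  ring

/-- The half-disc on which the regularised Hurwitz series converges uniformly. -/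
def halfDisc : Set ℂ := Metric.ball 0 3 ∩ {s | -(1 / 2) < s.re}

theorem isOpen_halfDisc : IsOpen halfDisc :=
  Metric.isOpen_ball.inter (isOpen_lt continuous_const Complex.continuous_re)

theorem norm_hurwitzTerm_le_of_mem {a : ℝ} (ha : 0 ≤ a) (ha1 : a ≤ 1) (k : ℕ) (s : ℂ)
    (hs : s ∈ halfDisc) : ‖hurwitzTerm a k s‖ ≤ 12 * ((k : ℝ) + 1) ^ (-(3 / 2) : ℝ) :=
  norm_hurwitzTerm_le ha ha1 k (Set.mem_ofPred_eq.mp hs.2 : _ < _).le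
    (by simpa using (Metric.mem_ball.1 hs.1).le)

theorem zero_mem_halfDisc : (0 : ℂ) ∈ halfDisc := ⟨by simp, by simp⟩

theorem summable_hurwitzBound : Summable fun k : ℕ ↦ 12 * ((k : ℝ) + 1) ^ (-(3 / 2) : ℝ) :=
  (summable_zetaSum (x := 3 / 2) (by norm_num)).mul_left 12

theorem differentiableOn_tsum_hurwitzTerm {a : ℝ} (ha : 0 ≤ a) (ha1 : a ≤ 1) :
    DifferentiableOn ℂ (fun s ↦ ∑' k, hurwitzTerm a k s) halfDisc :=
  Complex.differentiableOn_tsum_of_summable_norm summable_hurwitzBound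
    (fun k s _ ↦ (hasDerivAt_hurwitzTerm ha k s).differentiableAt.differentiableWithinAt)
    isOpen_halfDisc (norm_hurwitzTerm_le_of_mem ha ha1)

theorem hasDerivAt_tsum_hurwitzTerm {a : ℝ} (ha : 0 < a) (ha1 : a ≤ 1) :
    HasDerivAt (fun s ↦ ∑' k, hurwitzTerm a k s)
      ((Real.log (Real.Gamma a) + Real.log a + Real.eulerMascheroniConstant * a : ℝ) : ℂ) 0 := by
  have h := Complex.hasSum_deriv_of_summable_norm summable_hurwitzBound
    (fun k s _ ↦ (hasDerivAt_hurwitzTerm ha.le k s).differentiableAt.differentiableWithinAt)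
    isOpen_halfDisc (norm_hurwitzTerm_le_of_mem ha.le ha1) zero_mem_halfDisc
  have hd := ((differentiableOn_tsum_hurwitzTerm ha.le ha1).differentiableAt
    (isOpen_halfDisc.mem_nhds zero_mem_halfDisc)).hasDerivAt
  refine hd.congr_deriv (tendsto_nhds_unique h.tendsto_sum_nat ?_)
  have e (k : ℕ) : deriv (hurwitzTerm a k) 0 =
      ((-Real.log (k + 1 + a) + Real.log (k + 1) + a / (k + 1) : ℝ) : ℂ) := by
    rw [(hasDerivAt_hurwitzTerm ha.le k 0).deriv]
    have : ((k : ℂ) + 1) ≠ 0 := by exact_mod_cast Nat.succ_ne_zero k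
    simp [Complex.cpow_neg_one, div_eq_mul_inv]
  simp only [e]
  have hlim : Tendsto (fun n : ℕ ↦ Real.BohrMollerup.logGammaSeq a n + Real.log a +
      (harmonic n - Real.log n) * a) atTop
      (𝓝 (Real.log (Real.Gamma a) + Real.log a + Real.eulerMascheroniConstant * a)) :=
    ((Real.BohrMollerup.tendsto_log_gamma ha).add_const _).add
      (Real.tendsto_harmonic_sub_log.mul_const a)
  have hsum (n : ℕ) : ∑ k ∈ Finset.range n, (-Real.log (k + 1 + a) + Real.log (k + 1) +
      a / (k + 1)) = Real.BohrMollerup.logGammaSeq a n + Real.log a +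
      (harmonic n - Real.log n) * a := by
    rw [Real.BohrMollerup.logGammaSeq]
    have : ∑ m ∈ Finset.range (n + 1), Real.log (a + m) = Real.log a +
        ∑ k ∈ Finset.range n, Real.log (k + 1 + a) := by
      rw [Finset.sum_range_succ', add_comm]
      simp [add_comm]
    rw [this]
    have hf : Real.log (n.factorial : ℝ) = ∑ k ∈ Finset.range n, Real.log (k + 1) := by
      rw [← Finset.prod_range_add_one_eq_factorial]
      push_cast
      rw [Real.log_prod]
      intro i _
      positivity
    have hh : ((harmonic n : ℚ) : ℝ) * a = ∑ k ∈ Finset.range n, a / (k + 1) := by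
      simp [harmonic, Finset.mul_sum, div_eq_mul_inv, mul_comm]
    rw [Finset.sum_add_distrib, Finset.sum_add_distrib, Finset.sum_neg_distrib, hf, sub_mul, hh]
    ring
  have := (Complex.continuous_ofReal.tendsto _).comp hlim
  refine this.congr fun n ↦ ?_
  rw [Function.comp_apply, ← hsum]
  push_cast
  rfl

/-- The quadratic character of conductor `15` with complex values. -/
noncomputable def chi15 : DirichletCharacter ℂ 15 := chiInt.ringHomComp (Int.castRingHom ℂ)

theorem chi15_apply (j : ZMod 15) : chi15 j = (chiInt j : ℂ) := rfl

/-- The alternating sum of a function over the points `j / 15` weighted by the character. -/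
noncomputable def sumChi {R : Type*} [AddGroup R] (g : ℝ → R) : R :=
  g (1 / 15) + g (2 / 15) + g (4 / 15) + g (8 / 15) - g (7 / 15) - g (11 / 15) - g (13 / 15) -
    g (14 / 15)

theorem sum_chi15_mul (g : ℝ → ℂ) :
    ∑ j : ZMod 15, chi15 j * g (j.val / (15 : ℕ) : ℝ) = sumChi g := by
  have hu : (Finset.univ : Finset (ZMod 15)) =
      {0, 1, 2, 3, 4, 5, 6, 7, 8, 9, 10, 11, 12, 13, 14} := by
    decide
  have hv (j : ZMod 15) (m : ℤ) (h : chiInt j = m) : chi15 j = m := by rw [chi15_apply, h]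
  rw [hu]
  iterate 14 rw [Finset.sum_insert (by decide)]
  rw [Finset.sum_singleton, hv 0 (0) (by decide),
    hv 1 (1) (by decide),
    hv 2 (1) (by decide),
    hv 3 (0) (by decide),
    hv 4 (1) (by decide),
    hv 5 (0) (by decide),
    hv 6 (0) (by decide),
    hv 7 (-1) (by decide),
    hv 8 (1) (by decide),
    hv 9 (0) (by decide),
    hv 10 (0) (by decide),
    hv 11 (-1) (by decide),
    hv 12 (0) (by decide),
    hv 13 (-1) (by decide),
    hv 14 (-1) (by decide),
    show ((1 : ZMod 15).val = 1) from rfl, show ((2 : ZMod 15).val = 2) from rfl,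
    show ((4 : ZMod 15).val = 4) from rfl, show ((8 : ZMod 15).val = 8) from rfl,
    show ((7 : ZMod 15).val = 7) from rfl, show ((11 : ZMod 15).val = 11) from rfl,
    show ((13 : ZMod 15).val = 13) from rfl, show ((14 : ZMod 15).val = 14) from rfl]
  simp [sumChi]
  ring

theorem LFunction_chi15 (s : ℂ) :
    chi15.LFunction s = (15 : ℂ) ^ (-s) * sumChi fun a ↦ HurwitzZeta.hurwitzZeta a s := by
  rw [DirichletCharacter.LFunction, ZMod.LFunction, ← sum_chi15_mul]
  simp only [ZMod.toAddCircle_apply]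
  norm_cast

theorem hurwitzZeta_eq {a : ℝ} (ha : 0 ≤ a) (ha1 : a ≤ 1) {s : ℂ} (hs : 1 < s.re) :
    HurwitzZeta.hurwitzZeta a s = (a : ℂ) ^ (-s) + ∑' k, hurwitzTerm a k s + riemannZeta s -
      a * s * riemannZeta (s + 1) := by
  have h1 := HurwitzZeta.hasSum_hurwitzZeta_of_one_lt_re ⟨ha, ha1⟩ hs
  rw [← hasSum_nat_add_iff' 1] at h1
  have h0 (c : ℂ) (hc : 1 < c.re) :
      HasSum (fun k : ℕ ↦ ((k + 1 : ℝ) : ℂ) ^ (-c)) (riemannZeta c) := by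
    have := HurwitzZeta.hasSum_hurwitzZeta_of_one_lt_re (a := 1) ⟨zero_le_one, le_rfl⟩ hc
    have e : ((1 : ℝ) : UnitAddCircle) = 0 := AddCircle.coe_period 1
    rw [e, HurwitzZeta.hurwitzZeta_zero] at this
    refine this.congr_fun fun k ↦ ?_
    rw [Complex.cpow_neg, one_div]
    push_cast
    rfl
  have h2 := (h1.sub (h0 s hs)).add ((h0 (s + 1) (by simp; linarith)).mul_left (a * s))
  have h3 : HasSum (fun k ↦ hurwitzTerm a k s) _ := h2.congr_fun fun k ↦ by
    have e : -(s + 1) = -s - 1 := by ring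
    rw [hurwitzTerm, e, Complex.cpow_neg _ s, Complex.cpow_neg _ s]
    push_cast
    rw [one_div]
  rw [h3.tsum_eq]
  simp [Complex.cpow_neg]
  ring

/-- The regular part of the L-series near the origin. -/
noncomputable def regularPart (s : ℂ) : ℂ :=
  sumChi fun a ↦ (a : ℂ) ^ (-s) + ∑' k, hurwitzTerm a k s

theorem chi15_ne_one : chi15 ≠ 1 := by
  intro h
  have h1 : chi15 7 = 1 := by
    rw [h]; exact MulChar.one_apply (by decide)
  rw [chi15_apply, show chiInt 7 = -1 by decide] at h1
  norm_num at h1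

theorem HasDerivAt.sumChi {f : ℝ → ℂ → ℂ} {f' : ℝ → ℂ} {s : ℂ}
    (h : ∀ a : ℝ, 0 < a → a ≤ 1 → HasDerivAt (f a) (f' a) s) :
    HasDerivAt (fun s ↦ _root_.sumChi fun a ↦ f a s) (_root_.sumChi f') s :=
  ((((((((h _ (by norm_num) (by norm_num)).add (h _ (by norm_num) (by norm_num))).add
    (h _ (by norm_num) (by norm_num))).add (h _ (by norm_num) (by norm_num))).sub
    (h _ (by norm_num) (by norm_num))).sub (h _ (by norm_num) (by norm_num))).sub
    (h _ (by norm_num) (by norm_num))).sub (h _ (by norm_num) (by norm_num)))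

theorem hasDerivAt_regularPart {s : ℂ} (hs : s ∈ halfDisc) :
    HasDerivAt regularPart (sumChi fun a ↦ -(Real.log a * (a : ℂ) ^ (-s)) +
      deriv (fun s ↦ ∑' k, hurwitzTerm a k s) s) s := by
  refine HasDerivAt.sumChi fun a ha ha1 ↦ ?_
  have h1 := hasDerivAt_ofReal_cpow_neg ha 0 s
  simp only [sub_zero] at h1
  exact h1.add ((differentiableOn_tsum_hurwitzTerm ha.le ha1).differentiableAt
    (isOpen_halfDisc.mem_nhds hs)).hasDerivAt

theorem hasDerivAt_regularPart_zero :
    HasDerivAt regularPart ((sumChi (fun a ↦ Real.log (Real.Gamma a)) -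
      2 * Real.eulerMascheroniConstant : ℝ) : ℂ) 0 := by
  refine (HasDerivAt.sumChi (f' := fun a ↦ ((Real.log (Real.Gamma a) +
    Real.eulerMascheroniConstant * a : ℝ) : ℂ)) fun a ha ha1 ↦ ?_).congr_deriv ?_
  · have h1 := hasDerivAt_ofReal_cpow_neg ha 0 0
    simp only [sub_zero] at h1
    refine (h1.add (hasDerivAt_tsum_hurwitzTerm ha ha1)).congr_deriv ?_
    simp
    ring
  · simp only [sumChi]
    push_cast
    ring

theorem regularPart_zero : regularPart 0 = 0 := by
  simp [regularPart, sumChi, hurwitzTerm]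
  

theorem LFunction_chi15_eq {s : ℂ} (hs : 0 < s.re) (hs3 : ‖s‖ < 3) :
    (15 : ℂ) ^ s * chi15.LFunction s = regularPart s + 2 * s * riemannZeta (s + 1) := by
  let V : Set ℂ := Metric.ball 0 3 ∩ {s | 0 < s.re}
  have hV : IsOpen V := Metric.isOpen_ball.inter (isOpen_lt continuous_const Complex.continuous_re)
  have hVc : IsPreconnected V :=
    ((convex_ball (0 : ℂ) 3).inter (convex_halfSpace_re_gt 0)).isPreconnected
  have hVH {s : ℂ} (h : s ∈ V) : s ∈ halfDisc :=
    ⟨h.1, by have : 0 < s.re := h.2; change -(1 / 2) < s.re; linarith⟩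
  have hf : DifferentiableOn ℂ (fun s ↦ (15 : ℂ) ^ s * chi15.LFunction s) V := by
    refine Differentiable.differentiableOn ?_
    exact (differentiable_id.const_cpow (Or.inl (by norm_num))).mul
      (DirichletCharacter.differentiable_LFunction chi15_ne_one)
  have hg : DifferentiableOn ℂ (fun s ↦ regularPart s + 2 * s * riemannZeta (s + 1)) V := by
    intro s h
    have h0 : s ≠ 0 := by rintro rfl; simpa using (h.2 : (0 : ℝ) < (0 : ℂ).re)
    have hz : DifferentiableAt ℂ (fun s ↦ riemannZeta (s + 1)) s :=
      (differentiableAt_riemannZeta (s := s + 1) (by simpa using h0)).comp s (by fun_prop)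
    exact ((hasDerivAt_regularPart (hVH h)).differentiableAt.add
      ((by fun_prop : DifferentiableAt ℂ (fun s : ℂ ↦ 2 * s) s).mul hz)).differentiableWithinAt
  have h2V : (2 : ℂ) ∈ V := ⟨by simp; norm_num, by simp⟩
  refine (hf.analyticOnNhd hV).eqOn_of_preconnected_of_eventuallyEq (hg.analyticOnNhd hV) hVc h2V ?_
    ⟨by simpa using hs3, hs⟩
  have : {s : ℂ | 1 < s.re} ∈ 𝓝 (2 : ℂ) :=
    (isOpen_lt continuous_const Complex.continuous_re).mem_nhds (by simp)
  filter_upwards [this] with s hs1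
  rw [LFunction_chi15, ← mul_assoc, ← Complex.cpow_add _ _ (by norm_num), add_neg_cancel,
    Complex.cpow_zero, one_mul]
  simp only [sumChi, regularPart]
  repeat rw [hurwitzZeta_eq (by norm_num) (by norm_num) hs1]
  push_cast
  ring

theorem tendsto_riemannZeta_ofReal_add_one :
    Tendsto (fun x : ℝ ↦ riemannZeta ((x : ℂ) + 1) - 1 / (x : ℂ)) (𝓝[>] 0)
      (𝓝 (Real.eulerMascheroniConstant : ℂ)) := by
  have h : Tendsto (fun x : ℝ ↦ (x : ℂ) + 1) (𝓝[>] 0) (𝓝[≠] 1) := by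
    refine tendsto_nhdsWithin_iff.2 ⟨?_, ?_⟩
    · have : Tendsto (fun x : ℝ ↦ (x : ℂ) + 1) (𝓝 0) (𝓝 (((0 : ℝ) : ℂ) + 1)) :=
        (by fun_prop : Continuous fun x : ℝ ↦ (x : ℂ) + 1).tendsto 0
      simpa using this.mono_left nhdsWithin_le_nhds
    · filter_upwards [self_mem_nhdsWithin] with x hx
      simpa using (ne_of_gt hx : x ≠ 0)
  simpa [Function.comp_def] using tendsto_riemannZeta_sub_one_div.comp h

theorem tendsto_ofReal_nhdsGT_zero : Tendsto (fun x : ℝ ↦ (x : ℂ)) (𝓝[>] 0) (𝓝[≠] 0) := by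
  refine tendsto_nhdsWithin_iff.2 ⟨?_, ?_⟩
  · simpa using (Complex.continuous_ofReal.tendsto 0).mono_left nhdsWithin_le_nhds
  · filter_upwards [self_mem_nhdsWithin] with x hx
    simpa using (ne_of_gt hx : x ≠ 0)

theorem LFunction_chi15_ofReal_eventually : ∀ᶠ x : ℝ in 𝓝[>] 0,
    (15 : ℂ) ^ (x : ℂ) * chi15.LFunction x =
      regularPart x + 2 * x * (riemannZeta ((x : ℂ) + 1) - 1 / (x : ℂ)) + 2 := by
  filter_upwards [Ioc_mem_nhdsGT (show (0 : ℝ) < 2 by norm_num)] with x hx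
  have hx0 : (x : ℂ) ≠ 0 := by exact_mod_cast hx.1.ne'
  rw [LFunction_chi15_eq (by simpa using hx.1)
    (by rw [Complex.norm_real, Real.norm_of_nonneg hx.1.le]; linarith [hx.2])]
  field_simp
  ring

theorem hasDerivAt_LFunction_chi15_zero :
    HasDerivAt (fun s ↦ (15 : ℂ) ^ s * chi15.LFunction s)
      (Complex.log 15 * chi15.LFunction 0 + deriv chi15.LFunction 0) 0 := by
  have h1 := (hasDerivAt_id (0 : ℂ)).const_cpow (c := 15) (Or.inl (by norm_num))
  have h2 := (DirichletCharacter.differentiable_LFunction chi15_ne_one 0).hasDerivAt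
  refine (h1.mul h2).congr_deriv ?_
  simp

theorem LFunction_chi15_zero : chi15.LFunction 0 = 2 := by
  have h1 := hasDerivAt_LFunction_chi15_zero.continuousAt.tendsto.comp
    (tendsto_ofReal_nhdsGT_zero.mono_right nhdsWithin_le_nhds)
  have h2 := hasDerivAt_regularPart_zero.continuousAt.tendsto.comp
    (tendsto_ofReal_nhdsGT_zero.mono_right nhdsWithin_le_nhds)
  have h3 := (h2.add (((tendsto_ofReal_nhdsGT_zero.mono_right nhdsWithin_le_nhds).const_mul 2).mul
    tendsto_riemannZeta_ofReal_add_one)).add_const 2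
  have h4 := tendsto_nhds_unique (h1.congr' LFunction_chi15_ofReal_eventually) h3
  simpa [regularPart_zero] using h4

theorem deriv_LFunction_chi15_zero : deriv chi15.LFunction 0 =
    ((sumChi (fun a ↦ Real.log (Real.Gamma a)) - 2 * Real.log 15 : ℝ) : ℂ) := by
  have h1 := hasDerivAt_LFunction_chi15_zero.tendsto_slope.comp tendsto_ofReal_nhdsGT_zero
  have h2 := hasDerivAt_regularPart_zero.tendsto_slope.comp tendsto_ofReal_nhdsGT_zero
  have h3 := h2.add (tendsto_riemannZeta_ofReal_add_one.const_mul 2)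
  have h4 := tendsto_nhds_unique (h1.congr' ?_) h3
  · rw [LFunction_chi15_zero] at h4
    have h5 : Complex.log 15 = (Real.log 15 : ℝ) := by
      rw [Complex.ofReal_log (by norm_num)]; norm_num
    rw [h5] at h4
    push_cast at h4 ⊢
    linear_combination h4
  · filter_upwards [LFunction_chi15_ofReal_eventually, self_mem_nhdsWithin] with x hx hx0
    have hx0' : (x : ℂ) ≠ 0 := by exact_mod_cast (ne_of_gt hx0 : x ≠ 0)
    simp only [Function.comp_apply, slope_def_field, hx, regularPart_zero, Complex.cpow_zero,
      LFunction_chi15_zero, sub_zero]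
    field_simp
    ring

theorem not_factorsThrough_chi15 {d : ℕ} (hd : d ∣ 15) (u : (ZMod 15)ˣ)
    (hu : ZMod.unitsMap hd u = 1) (h1 : chiInt (u : ZMod 15) = -1) :
    ¬ chi15.FactorsThrough d := by
  intro h
  have h2 := (DirichletCharacter.factorsThrough_iff_ker_unitsMap hd).1 h (MonoidHom.mem_ker.2 hu)
  have h3 : chi15 (u : ZMod 15) = 1 := by
    rw [← MulChar.coe_toUnitHom, MonoidHom.mem_ker.1 h2, Units.val_one]
  rw [chi15_apply, h1] at h3
  norm_num at h3

theorem isPrimitive_chi15 : chi15.IsPrimitive := by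
  have h3 : ¬ chi15.FactorsThrough 3 :=
    not_factorsThrough_chi15 (by norm_num) (ZMod.unitOfCoprime 7 (by norm_num)) (by decide)
      (by decide)
  have h5 : ¬ chi15.FactorsThrough 5 :=
    not_factorsThrough_chi15 (by norm_num) (ZMod.unitOfCoprime 11 (by norm_num)) (by decide)
      (by decide)
  have hf := chi15.factorsThrough_conductor
  have hd := chi15.conductor_dvd_level
  rw [DirichletCharacter.isPrimitive_def]
  have hle := Nat.le_of_dvd (by norm_num) hd
  generalize chi15.conductor = c at *
  interval_cases c <;> try omega
  · exact absurd (hf.mono chi15 (by norm_num) (by norm_num)) h3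
  · exact absurd hf h3
  · exact absurd hf h5

theorem odd_chi15 : chi15.Odd := by
  rw [DirichletCharacter.Odd, chi15_apply, show chiInt (-1) = -1 by decide]
  norm_num

theorem inv_chi15 : chi15⁻¹ = chi15 := by
  rw [inv_eq_iff_mul_eq_one]
  have h : chiInt * chiInt = 1 := by
    have h0 : ∀ a b : ZMod 15, a * b = 1 → chiInt a * chiInt a = 1 := by decide
    ext u
    rw [MulChar.mul_apply, h0 u _ u.mul_inv, MulChar.one_apply_coe]
  have : chi15 * chi15 = (chiInt * chiInt).ringHomComp (Int.castRingHom ℂ) := by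
    rw [MulChar.ringHomComp_mul]; rfl
  rw [this, h, MulChar.ringHomComp_one]

theorem hasDerivAt_Gammaℝ_two : HasDerivAt Complex.Gammaℝ
    (Complex.Gammaℝ 2 * (-(Real.log π + Real.eulerMascheroniConstant) / 2 : ℝ)) 2 := by
  have h1 : HasDerivAt (fun s : ℂ ↦ -s / 2) (-1 / 2) 2 := (hasDerivAt_id _).neg.div_const 2
  have h2 := h1.const_cpow (c := (π : ℂ)) (Or.inl (by exact_mod_cast Real.pi_ne_zero))
  have h3 : HasDerivAt (fun s : ℂ ↦ s / 2) (1 / 2) 2 := (hasDerivAt_id _).div_const 2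
  have h4 : HasDerivAt Complex.Gamma (-Real.eulerMascheroniConstant) ((2 : ℂ) / 2) := by
    rw [div_self two_ne_zero]
    exact Complex.hasDerivAt_Gamma_one
  have h5 := h2.mul (h4.comp (h := fun s : ℂ ↦ s / 2) 2 h3)
  refine (h5.congr_deriv ?_ : HasDerivAt Complex.Gammaℝ _ 2)
  rw [Complex.Gammaℝ_def, Function.comp_apply, div_self two_ne_zero, Complex.Gamma_one,
    ← Complex.ofReal_log Real.pi_pos.le]
  push_cast
  ring

theorem deriv_LFunction_chi15_one : deriv chi15.LFunction 1 = chi15.LFunction 1 *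
    ((Real.eulerMascheroniConstant + Real.log (2 * π) -
      sumChi (fun a ↦ Real.log (Real.Gamma a)) / 2 : ℝ) : ℂ) := by
  have hL := DirichletCharacter.differentiable_LFunction chi15_ne_one
  have hcomp (s : ℂ) (hs : 0 < (s + 1).re) :
      chi15.completedLFunction s = chi15.LFunction s * Complex.Gammaℝ (s + 1) := by
    rw [DirichletCharacter.LFunction_eq_completed_div_gammaFactor chi15 s (Or.inr (by norm_num)),
      odd_chi15.gammaFactor_def, div_mul_cancel₀ _ (Complex.Gammaℝ_ne_zero_of_re_pos hs)]
  set W := DirichletCharacter.rootNumber chi15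
  have hfe : ∀ᶠ s : ℂ in 𝓝 0, chi15.LFunction (1 - s) * Complex.Gammaℝ (1 - s + 1) =
      (15 : ℂ) ^ (s - 1 / 2) * W * (chi15.LFunction s * Complex.Gammaℝ (s + 1)) := by
    have : Metric.ball (0 : ℂ) 1 ∈ 𝓝 (0 : ℂ) := Metric.ball_mem_nhds _ one_pos
    filter_upwards [this] with s hs
    have hs1 := (Complex.abs_re_le_norm s).trans_lt (by simpa using hs : ‖s‖ < 1)
    have hs2 := abs_lt.1 hs1
    have h := isPrimitive_chi15.completedLFunction_one_sub s
    rw [inv_chi15, hcomp _ (by simp; linarith), hcomp _ (by simp; linarith)] at h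
    exact_mod_cast h
  have d1 : HasDerivAt (fun s : ℂ ↦ 1 - s) (-1) 0 := by
    simpa using (hasDerivAt_id (0 : ℂ)).const_sub 1
  have d2 : HasDerivAt (fun s : ℂ ↦ 1 - s + 1) (-1) 0 := d1.add_const 1
  have d3 : HasDerivAt (fun s : ℂ ↦ s + 1) 1 0 := (hasDerivAt_id (0 : ℂ)).add_const 1
  have d4 : HasDerivAt (fun s : ℂ ↦ s - 1 / 2) 1 0 := (hasDerivAt_id (0 : ℂ)).sub_const _
  have dL1 : HasDerivAt chi15.LFunction (deriv chi15.LFunction 1) ((1 : ℂ) - 0) := by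
    rw [sub_zero]; exact (hL 1).hasDerivAt
  have dL0 := (hL 0).hasDerivAt
  have dG2 : HasDerivAt Complex.Gammaℝ (Complex.Gammaℝ 2 *
      (-(Real.log π + Real.eulerMascheroniConstant) / 2 : ℝ)) ((1 : ℂ) - 0 + 1) := by
    rw [sub_zero, one_add_one_eq_two]
    exact hasDerivAt_Gammaℝ_two
  have dG1 : HasDerivAt Complex.Gammaℝ (-(Real.eulerMascheroniConstant +
      Complex.log (4 * π)) / 2) ((0 : ℂ) + 1) := by
    rw [zero_add]
    exact Complex.hasDerivAt_Gammaℝ_one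
  have e1 := (dL1.comp (h := fun s : ℂ ↦ 1 - s) 0 d1).mul
    (dG2.comp (h := fun s : ℂ ↦ 1 - s + 1) 0 d2)
  have e2 := ((d4.const_cpow (c := 15) (Or.inl (by norm_num))).mul_const W).mul
    (dL0.mul (dG1.comp (h := fun s : ℂ ↦ s + 1) 0 d3))
  have h1 := (e1.congr_of_eventuallyEq (hfe.mono fun s h ↦ h.symm)).unique e2
  have h0 := hfe.self_of_nhds
  have hlog : Complex.log 15 = (Real.log 15 : ℝ) := by
    rw [Complex.ofReal_log (by norm_num)]; norm_num
  have hlog4 : Complex.log (4 * π) = (2 * Real.log 2 + Real.log π : ℝ) := by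
    rw [show (4 : ℂ) * π = ((4 * π : ℝ) : ℂ) by push_cast; rfl,
      ← Complex.ofReal_log (by positivity),
      Real.log_mul (by norm_num) Real.pi_ne_zero, show (4 : ℝ) = 2 ^ 2 by norm_num, Real.log_pow]
    norm_num
  have hG : Complex.Gammaℝ 2 ≠ 0 := Complex.Gammaℝ_ne_zero_of_re_pos (by norm_num)
  rw [Real.log_mul two_ne_zero Real.pi_ne_zero]
  simp only [Function.comp_apply, sub_zero, zero_add, one_add_one_eq_two, Complex.Gammaℝ_one,
    LFunction_chi15_zero, deriv_LFunction_chi15_zero, hlog, hlog4] at h0 h1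
  rw [zero_sub] at h0 h1
  generalize (15 : ℂ) ^ (-(1 / 2) : ℂ) = c at *
  refine mul_right_cancel₀ hG ?_
  push_cast at h0 h1 ⊢
  generalize ((sumChi fun a ↦ Real.log (Real.Gamma a) : ℝ) : ℂ) = S at *
  rw [Pi.mul_apply, Function.comp_apply, zero_add, Complex.Gammaℝ_one, LFunction_chi15_zero] at h1
  linear_combination -h1 + (S / 2 - (Real.eulerMascheroniConstant + 2 * Real.log 2 +
    Real.log π) / 2) * h0

/-- `f s = a / (s - 1) + α + o(1)` as `s` decreases to `1`. -/
def HasPolarExpansion (f : ℝ → ℂ) (a α : ℂ) : Prop :=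
  Tendsto (fun s : ℝ ↦ f s - a / (s - 1)) (𝓝[>] 1) (𝓝 α)

theorem tendsto_sub_one_nhdsGT : Tendsto (fun s : ℝ ↦ (s : ℂ) - 1) (𝓝[>] 1) (𝓝 0) := by
  have : Continuous fun s : ℝ ↦ (s : ℂ) - 1 := by fun_prop
  simpa using (this.tendsto 1).mono_left nhdsWithin_le_nhds

theorem eventually_sub_one_ne_zero : ∀ᶠ s : ℝ in 𝓝[>] 1, (s : ℂ) - 1 ≠ 0 := by
  filter_upwards [self_mem_nhdsWithin] with s (hs : 1 < s)
  exact_mod_cast (sub_pos.2 hs).ne'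

namespace HasPolarExpansion

variable {f g : ℝ → ℂ} {a b α β : ℂ}

theorem of_tendsto_ofReal {f : ℝ → ℝ} {a α : ℝ}
    (h : Tendsto (fun s ↦ f s - a / (s - 1)) (𝓝[>] 1) (𝓝 α)) :
    HasPolarExpansion (fun s ↦ f s) a α := by
  refine ((Complex.continuous_ofReal.tendsto α).comp h).congr fun s ↦ ?_
  simp

theorem congr (hf : HasPolarExpansion f a α) (h : ∀ s : ℝ, 1 < s → f s = g s) :
    HasPolarExpansion g a α := by
  refine Tendsto.congr' ?_ hf
  filter_upwards [self_mem_nhdsWithin] with s hs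
  rw [h s hs]

theorem add (hf : HasPolarExpansion f a α) (hg : HasPolarExpansion g b β) :
    HasPolarExpansion (fun s ↦ f s + g s) (a + b) (α + β) :=
  (Tendsto.add hf hg).congr fun s ↦ by ring

theorem tendsto_mul_sub_one (hf : HasPolarExpansion f a α) :
    Tendsto (fun s : ℝ ↦ f s * (s - 1)) (𝓝[>] 1) (𝓝 a) := by
  have h := (Tendsto.mul hf tendsto_sub_one_nhdsGT).add_const a
  rw [mul_zero, zero_add] at h
  refine h.congr' ?_
  filter_upwards [eventually_sub_one_ne_zero] with s hs
  field_simp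
  ring

theorem unique (hf : HasPolarExpansion f a α) (hf' : HasPolarExpansion f b β) :
    a = b ∧ α = β := by
  obtain rfl := tendsto_nhds_unique hf.tendsto_mul_sub_one hf'.tendsto_mul_sub_one
  exact ⟨rfl, tendsto_nhds_unique hf hf'⟩

theorem mul_of_hasDerivAt {g : ℂ → ℂ} {d : ℂ} (hf : HasPolarExpansion f a α)
    (hg : HasDerivAt g d 1) :
    HasPolarExpansion (fun s ↦ g s * f s) (g 1 * a) (g 1 * α + d * a) := by
  have hg' : HasDerivAt (fun s : ℝ ↦ g s) d 1 :=
    HasDerivAt.comp_ofReal (by rwa [Complex.ofReal_one])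
  have h1 : Tendsto (fun s : ℝ ↦ g s) (𝓝[>] 1) (𝓝 (g 1)) := by
    have := hg'.continuousAt.tendsto.mono_left (nhdsWithin_le_nhds (s := Set.Ioi 1))
    rwa [Complex.ofReal_one] at this
  have h2 : Tendsto (fun s : ℝ ↦ (g s - g 1) / (s - 1)) (𝓝[>] 1) (𝓝 d) := by
    refine ((hasDerivAt_iff_tendsto_slope.1 hg').mono_left
      (nhdsWithin_mono _ fun s (hs : 1 < s) ↦ hs.ne')).congr fun s ↦ ?_
    rw [slope_def_module, Complex.real_smul]
    push_cast
    ring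
  refine ((h1.mul hf).add (h2.mul_const a)).congr fun s ↦ ?_
  ring

end HasPolarExpansion

theorem hasPolarExpansion_riemannZeta :
    HasPolarExpansion (fun s ↦ riemannZeta s) 1 Real.eulerMascheroniConstant := by
  have h := HasPolarExpansion.of_tendsto_ofReal tendsto_zetaSum_sub
  rw [Complex.ofReal_one] at h
  exact h.congr fun s hs ↦ (riemannZeta_ofReal hs).symm

theorem tsum_fiber_eq {ι : Type*} (N : ι → ℕ) (hfin : ∀ n, (N ⁻¹' {n}).Finite) (g : ℕ → ℝ)
    (hs : Summable fun i ↦ g (N i)) :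
    HasSum (fun n ↦ ((N ⁻¹' {n}).ncard : ℝ) * g n) (∑' i, g (N i)) := by
  have h1 := (Equiv.sigmaFiberEquiv N).hasSum_iff.2 hs.hasSum
  refine h1.sigma fun n ↦ ?_
  have : Finite {i // N i = n} := hfin n
  have h3 : HasSum (fun _ : {i // N i = n} ↦ g n) (((N ⁻¹' {n}).ncard : ℝ) * g n) := by
    have := Fintype.ofFinite {i // N i = n}
    convert hasSum_fintype (fun _ : {i // N i = n} ↦ g n) using 1
    rw [Finset.sum_const, nsmul_eq_mul, Finset.card_univ, ← Nat.card_eq_fintype_card]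
    rfl
  refine h3.congr_fun fun i ↦ ?_
  simp [Equiv.sigmaFiberEquiv, i.2]

theorem hasSum_ncard_ellipsePoints {a b : ℤ} (ha : 0 < a) (hb : 0 < b) (ha2 : a % 2 = 1)
    (hb2 : b % 2 = 1) {Q : ℤ × ℤ → ℤ} {φ : ℤ × ℤ → ℤ × ℤ} (hφ : φ.Injective)
    (hQ : ∀ p, a * (φ p).1 ^ 2 + b * (φ p).2 ^ 2 = 4 * Q p)
    (hφ2 : ∀ w : ℤ × ℤ, w.1 % 2 = w.2 % 2 → ∃ p, φ p = w) {g : ℕ → ℝ}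
    (hs : Summable fun p ↦ g (Q p).natAbs) :
    HasSum (fun n : ℕ ↦ ((ellipsePoints a b n).ncard : ℝ) * g n) (∑' p, g (Q p).natAbs) := by
  have hnat (p) : ((Q p).natAbs : ℤ) = Q p :=
    Int.natAbs_of_nonneg (by have := hQ p; nlinarith [sq_nonneg (φ p).1, sq_nonneg (φ p).2])
  have him (n : ℕ) : φ '' ((fun p ↦ (Q p).natAbs) ⁻¹' {n}) = ellipsePoints a b n := by
    ext w
    constructor
    · rintro ⟨p, rfl, rfl⟩
      change a * (φ p).1 ^ 2 + b * (φ p).2 ^ 2 = 4 * (((Q p).natAbs : ℕ) : ℤ)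
      rw [hQ, hnat]
    · intro hw
      obtain ⟨p, rfl⟩ := hφ2 w (emod_two_eq_of_mem_ellipsePoints ha2 hb2 hw)
      refine ⟨p, ?_, rfl⟩
      have h : a * (φ p).1 ^ 2 + b * (φ p).2 ^ 2 = 4 * (n : ℤ) := hw
      rw [hQ, ← hnat] at h
      change (Q p).natAbs = n
      omega
  have h := tsum_fiber_eq (fun p ↦ (Q p).natAbs)
    (fun n ↦ Set.Finite.of_finite_image (by rw [him]; exact ellipsePoints_finite ha hb n) hφ.injOn)
    g hs
  refine h.congr_fun fun n ↦ ?_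
  rw [← him, Set.ncard_image_of_injective _ hφ]

theorem sum_repCount_eq {s : ℝ} (hs : 1 < s) {S : ℝ}
    (h : HasSum (fun n : ℕ ↦ (repCount n : ℝ) * (n : ℝ) ^ (-s)) S) :
    (S : ℂ) = 2 * (riemannZeta s * chi15.LFunction s) := by
  have hs' : 1 < (s : ℂ).re := by simpa
  have hc := (LSeriesSummable_one_iff.2 hs').LSeriesHasSum.convolution
    (DirichletCharacter.LSeriesSummable_of_one_lt_re chi15 hs').LSeriesHasSum
  have h2 := (hc.mul_left 2).unique (((Complex.hasSum_ofReal.2 h)).congr_fun fun n ↦ ?_)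
  · rw [← h2, LSeries_one_eq_riemannZeta hs', DirichletCharacter.LFunction_eq_LSeries chi15 hs']
  · rcases eq_or_ne n 0 with rfl | hn
    · rw [LSeries.term_zero, Nat.cast_zero, Real.zero_rpow (by linarith)]
      simp
    · rw [LSeries.term_of_ne_zero hn, LSeries.convolution_def, repCount_eq_sum_divisors hn]
      beta_reduce
      rw [Nat.sum_divisorsAntidiagonal' (f := fun i j ↦ (1 : ℕ → ℂ) i * chi15 (j : ZMod 15)),
        Real.rpow_neg n.cast_nonneg]
      push_cast
      rw [Complex.ofReal_cpow n.cast_nonneg]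
      simp only [Pi.one_apply, one_mul, chi15_apply, Complex.ofReal_natCast]
      ring

/-- The point `(1 + √-15) / 2`. -/
noncomputable def cmPointOne : UpperHalfPlane :=
  ⟨⟨1 / 2, Real.sqrt 15 / 2⟩, by positivity⟩

/-- The point `(1 + √-15) / 4`. -/
noncomputable def cmPointTwo : UpperHalfPlane :=
  ⟨⟨1 / 4, Real.sqrt 15 / 4⟩, by positivity⟩

theorem normSq_cmPointOne (p : ℤ × ℤ) : Complex.normSq (p.1 * cmPointOne + p.2) =
    ((4 * p.1 ^ 2 + p.1 * p.2 + p.2 ^ 2 : ℤ) : ℝ) := by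
  have h : Real.sqrt 15 ^ 2 = 15 := Real.sq_sqrt (by norm_num)
  rw [Complex.normSq_apply]
  simp only [cmPointOne, Complex.add_re, Complex.add_im, Complex.mul_re, Complex.mul_im,
    Complex.intCast_re, Complex.intCast_im]
  push_cast
  linear_combination (p.1 : ℝ) ^ 2 / 4 * h

theorem normSq_cmPointTwo (p : ℤ × ℤ) : 2 * Complex.normSq (p.1 * cmPointTwo + p.2) =
    ((2 * p.1 ^ 2 + p.1 * p.2 + 2 * p.2 ^ 2 : ℤ) : ℝ) := by
  have h : Real.sqrt 15 ^ 2 = 15 := Real.sq_sqrt (by norm_num)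
  rw [Complex.normSq_apply]
  simp only [cmPointTwo, Complex.add_re, Complex.add_im, Complex.mul_re, Complex.mul_im,
    Complex.intCast_re, Complex.intCast_im]
  push_cast
  linear_combination (p.1 : ℝ) ^ 2 / 8 * h

theorem cast_natAbs_of_eq {x : ℝ} (hx : 0 ≤ x) {k : ℤ} (h : x = k) : ((k.natAbs : ℕ) : ℝ) = x := by
  rw [Nat.cast_natAbs, Int.cast_abs, ← h, abs_of_nonneg hx]

theorem hasSum_repCount {s : ℝ} (hs : 1 < s) :
    HasSum (fun n : ℕ ↦ (repCount n : ℝ) * (n : ℝ) ^ (-s))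
      (∑' p : ℤ × ℤ, Complex.normSq (p.1 * cmPointOne + p.2) ^ (-s) +
        2 ^ (-s) * ∑' p : ℤ × ℤ, Complex.normSq (p.1 * cmPointTwo + p.2) ^ (-s)) := by
  have e1 (p : ℤ × ℤ) : (((4 * p.1 ^ 2 + p.1 * p.2 + p.2 ^ 2 : ℤ).natAbs : ℕ) : ℝ) ^ (-s) =
      Complex.normSq (p.1 * cmPointOne + p.2) ^ (-s) := by
    rw [cast_natAbs_of_eq (Complex.normSq_nonneg _) (normSq_cmPointOne p)]
  have e2 (p : ℤ × ℤ) : (((2 * p.1 ^ 2 + p.1 * p.2 + 2 * p.2 ^ 2 : ℤ).natAbs : ℕ) : ℝ) ^ (-s) =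
      2 ^ (-s) * Complex.normSq (p.1 * cmPointTwo + p.2) ^ (-s) := by
    rw [cast_natAbs_of_eq (mul_nonneg zero_le_two (Complex.normSq_nonneg _)) (normSq_cmPointTwo p),
      Real.mul_rpow zero_le_two (Complex.normSq_nonneg _)]
  have h1 := hasSum_ncard_ellipsePoints (a := 1) (b := 15) (by norm_num) (by norm_num)
    (by norm_num) (by norm_num) (Q := fun p ↦ 4 * p.1 ^ 2 + p.1 * p.2 + p.2 ^ 2)
    (φ := fun p ↦ (p.1 + 2 * p.2, p.1))
    (fun p q h ↦ by simp only [Prod.mk.injEq] at h; ext <;> lia)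
    (fun p ↦ by ring)
    (fun w h ↦ ⟨(w.2, (w.1 - w.2) / 2), by ext <;> simp only; lia⟩)
    (g := fun n ↦ (n : ℝ) ^ (-s)) ((summable_normSq_rpow cmPointOne hs).congr fun p ↦ (e1 p).symm)
  have h2 := hasSum_ncard_ellipsePoints (a := 5) (b := 3) (by norm_num) (by norm_num)
    (by norm_num) (by norm_num) (Q := fun p ↦ 2 * p.1 ^ 2 + p.1 * p.2 + 2 * p.2 ^ 2)
    (φ := fun p ↦ (p.1 + p.2, p.1 - p.2))
    (fun p q h ↦ by simp only [Prod.mk.injEq] at h; ext <;> lia)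
    (fun p ↦ by ring)
    (fun w h ↦ ⟨((w.1 + w.2) / 2, (w.1 - w.2) / 2), by ext <;> simp only <;> lia⟩)
    (g := fun n ↦ (n : ℝ) ^ (-s))
    (((summable_normSq_rpow cmPointTwo hs).mul_left (2 ^ (-s))).congr fun p ↦ (e2 p).symm)
  simp only [e1, e2, tsum_mul_left] at h1 h2
  refine (h1.add h2).congr_fun fun n ↦ ?_
  rw [repCount]
  push_cast
  ring

theorem hasPolarExpansion_lattice (z : UpperHalfPlane) :
    HasPolarExpansion
      (fun s ↦ (∑' p : ℤ × ℤ, Complex.normSq (p.1 * z + p.2) ^ (-s) : ℝ)) (π / z.im : ℝ)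
      (π / z.im * (2 * Real.eulerMascheroniConstant - 2 * Real.log 2 - 2 * Real.log z.im) -
        4 * π / z.im * Real.log ‖ModularForm.eta z‖ : ℝ) := by
  refine HasPolarExpansion.of_tendsto_ofReal ((tendsto_lattice_sub z).congr fun s ↦ ?_)
  rw [div_div]

theorem log_norm_eta_cmPoint :
    2 * Real.log ‖ModularForm.eta cmPointOne‖ + 2 * Real.log ‖ModularForm.eta cmPointTwo‖ =
      sumChi (fun a ↦ Real.log (Real.Gamma a)) / 2 - Real.log π - 7 / 2 * Real.log 2
        - Real.log (cmPointOne.im * cmPointTwo.im) := by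
  have hd : HasDerivAt (fun s : ℂ ↦ (2 : ℂ) ^ (-s)) (-(Real.log 2 / 2 : ℝ)) 1 := by
    refine ((hasDerivAt_neg (1 : ℂ)).const_cpow (c := 2) (Or.inl two_ne_zero)).congr_deriv ?_
    rw [Complex.cpow_neg_one, Complex.ofReal_div, Complex.ofReal_log zero_le_two]
    push_cast
    ring
  have hL := (DirichletCharacter.differentiable_LFunction chi15_ne_one 1).hasDerivAt
  have hR := hasPolarExpansion_riemannZeta.mul_of_hasDerivAt (hL.const_mul 2)
  have hK := (hasPolarExpansion_lattice cmPointOne).add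
    ((hasPolarExpansion_lattice cmPointTwo).mul_of_hasDerivAt hd)
  obtain ⟨hA, hB⟩ := hR.unique (hK.congr fun s hs ↦ by
    have h := sum_repCount_eq hs (hasSum_repCount hs)
    rw [Complex.ofReal_add, Complex.ofReal_mul, Complex.ofReal_cpow zero_le_two] at h
    push_cast at h ⊢
    rw [h]
    ring)
  set P := π / cmPointOne.im with hP
  have hP0 : P ≠ 0 := (div_pos Real.pi_pos cmPointOne.im_pos).ne'
  have hy : π / cmPointTwo.im = 2 * P := by
    rw [hP, show cmPointTwo.im = cmPointOne.im / 2 by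
      change Real.sqrt 15 / 4 = Real.sqrt 15 / 2 / 2; ring]
    have := cmPointOne.im_ne_zero
    field_simp
  have hP4 : 4 * π / cmPointOne.im = 4 * P := mul_div_assoc _ _ _
  have hy4 : 4 * π / cmPointTwo.im = 8 * P := by rw [mul_div_assoc, hy]; ring
  rw [hP4, hy4, hy, Complex.cpow_neg_one] at hB
  rw [hy, Complex.cpow_neg_one] at hA
  have hL1 : chi15.LFunction 1 = (P : ℂ) := by
    push_cast at hA
    linear_combination hA / 2
  rw [deriv_LFunction_chi15_one, hL1] at hB
  rw [Real.log_mul cmPointOne.im_ne_zero cmPointTwo.im_ne_zero]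
  have hlog : Real.log (2 * π) = Real.log 2 + Real.log π := Real.log_mul two_ne_zero Real.pi_ne_zero
  rw [hlog] at hB
  refine mul_left_cancel₀ hP0 (Complex.ofReal_injective ?_)
  push_cast at hB ⊢
  linear_combination hB / 2

/-- The Euler product `∏ (1 - q ^ n)` over `n ≥ 1`. -/
noncomputable def eulerProd (q : ℂ) : ℂ := ∏' n : ℕ, (1 - q ^ (n + 1))

/-- The product of `1 - q ^ n` over odd `n`. -/
noncomputable def oddEulerProd (q : ℂ) : ℂ := ∏' n : ℕ, (1 - q ^ (2 * n + 1))

theorem multipliable_one_sub_pow_odd {q : ℂ} (hq : ‖q‖ < 1) :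
    Multipliable fun n : ℕ ↦ 1 - q ^ (2 * n + 1) := by
  have h := (summable_geometric_of_lt_one (norm_nonneg q) hq).comp_injective
    (i := fun n : ℕ ↦ 2 * n + 1) fun a b hab ↦ by simpa using hab
  have := multipliable_one_add_of_summable (f := fun n : ℕ ↦ -q ^ (2 * n + 1)) (by simpa using! h)
  simpa [sub_eq_add_neg] using this

theorem oddEulerProd_mul {q : ℂ} (hq : ‖q‖ < 1) :
    oddEulerProd q * eulerProd (q ^ 2) = eulerProd q := by
  have hq2 : ‖q ^ 2‖ < 1 := norm_pow_succ_lt_one hq 1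
  rw [oddEulerProd, eulerProd, eulerProd]
  refine Eq.trans ?_ (tprod_even_mul_odd (f := fun n : ℕ ↦ 1 - q ^ (n + 1)) ?_ ?_)
  · congr 2
    ext n
    rw [← pow_mul, mul_add_one]
  · exact multipliable_one_sub_pow_odd hq
  · refine (ModularForm.multipliable_one_sub_pow hq2).congr fun n ↦ ?_
    rw [← pow_mul, mul_add_one]

theorem oddEulerProd_mul_neg {q : ℂ} (hq : ‖q‖ < 1) :
    oddEulerProd q * oddEulerProd (-q) = oddEulerProd (q ^ 2) := by
  rw [oddEulerProd, oddEulerProd, oddEulerProd,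
    ← (multipliable_one_sub_pow_odd hq).tprod_mul
      (multipliable_one_sub_pow_odd (by rwa [norm_neg]))]
  congr 1
  ext n
  rw [Odd.neg_pow ⟨n, rfl⟩]
  ring

theorem eulerProd_duplication {q : ℂ} (hq : ‖q‖ < 1) :
    eulerProd q * eulerProd (-q) * eulerProd ((q ^ 2) ^ 2) = eulerProd (q ^ 2) ^ 3 := by
  have h := oddEulerProd_mul (q := -q) (by rwa [norm_neg])
  rw [neg_sq] at h
  rw [← oddEulerProd_mul hq, ← h, mul_mul_mul_comm, oddEulerProd_mul_neg hq]
  linear_combination eulerProd (q ^ 2) ^ 2 * oddEulerProd_mul (norm_pow_succ_lt_one hq 1)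

theorem norm_eta_eq (z : ℂ) : ‖ModularForm.eta z‖ =
    Real.exp (-(π * z.im / 12)) * ‖eulerProd (Complex.exp (2 * π * Complex.I * z))‖ := by
  simp only [ModularForm.eta, eulerProd, norm_mul, ModularForm.eta_q_eq_pow,
    Function.Periodic.norm_qParam]
  ring_nf

theorem norm_eta_add_one (z : ℂ) : ‖ModularForm.eta (z + 1)‖ = ‖ModularForm.eta z‖ := by
  rw [norm_eta_eq, norm_eta_eq, mul_add, mul_one, Complex.exp_add, Complex.exp_two_pi_mul_I]
  simp

theorem norm_eta_neg_conj {z : ℂ} (hz : 0 < z.im) :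
    ‖ModularForm.eta (-(starRingEnd ℂ z))‖ = ‖ModularForm.eta z‖ := by
  have hq : Complex.exp (2 * π * Complex.I * -(starRingEnd ℂ z)) =
      starRingEnd ℂ (Complex.exp (2 * π * Complex.I * z)) := by
    rw [← Complex.exp_conj]
    simp [show starRingEnd ℂ 2 = 2 from Complex.conj_ofNat 2]
  rw [norm_eta_eq, norm_eta_eq, hq]
  simp only [Complex.neg_im, Complex.conj_im, neg_neg]
  congr 1
  have hn : ‖Complex.exp (2 * π * Complex.I * z)‖ < 1 :=
    UpperHalfPlane.norm_exp_two_pi_I_lt_one ⟨z, hz⟩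
  rw [eulerProd, eulerProd, (ModularForm.multipliable_one_sub_pow hn).norm_tprod,
    (ModularForm.multipliable_one_sub_pow (by rwa [RCLike.norm_conj])).norm_tprod]
  congr 1
  ext n
  rw [← RCLike.norm_conj]
  simp

theorem norm_eta_inv {z : ℂ} (hz : 0 < z.im) :
    ‖ModularForm.eta (-1 / z)‖ ^ 2 = ‖z‖ * ‖ModularForm.eta z‖ ^ 2 := by
  have hsq (w : ℂ) : Complex.sqrt w ^ 2 = w := Complex.cpow_nat_inv_pow w two_ne_zero
  have h := congr_arg (fun w ↦ ‖w‖ ^ 2) (ModularForm.eta_comp_eq_csqrt_I_inv hz)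
  simp only [Function.comp_apply, Pi.smul_apply, Pi.mul_apply, smul_eq_mul, norm_mul, norm_inv,
    mul_pow, inv_pow, ← norm_pow (Complex.sqrt _), hsq, Complex.norm_I, inv_one, one_mul] at h
  exact h

theorem norm_eta_duplication {z : ℂ} (hz : 0 < z.im) :
    ‖ModularForm.eta (z / 2)‖ * ‖ModularForm.eta ((z + 1) / 2)‖ * ‖ModularForm.eta (2 * z)‖ =
      ‖ModularForm.eta z‖ ^ 3 := by
  set q := Complex.exp (2 * π * Complex.I * (z / 2)) with hq
  have hn : ‖q‖ < 1 := UpperHalfPlane.norm_exp_two_pi_I_lt_one ⟨z / 2, by simpa using hz⟩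
  have h1 : Complex.exp (2 * π * Complex.I * ((z + 1) / 2)) = -q := by
    rw [show 2 * π * Complex.I * ((z + 1) / 2) =
      2 * π * Complex.I * (z / 2) + π * Complex.I by ring,
      Complex.exp_add, Complex.exp_pi_mul_I, mul_neg_one]
  have h2 : Complex.exp (2 * π * Complex.I * z) = q ^ 2 := by
    rw [hq, ← Complex.exp_nat_mul]; push_cast; ring_nf
  have h3 : Complex.exp (2 * π * Complex.I * (2 * z)) = (q ^ 2) ^ 2 := by
    rw [← h2, ← Complex.exp_nat_mul]; push_cast; ring_nf
  have h := congr_arg (‖·‖) (eulerProd_duplication hn)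
  simp only [norm_mul, norm_pow] at h
  rw [norm_eta_eq, norm_eta_eq, norm_eta_eq, norm_eta_eq, h1, h2, h3, ← hq, mul_pow, ← h,
    ← Real.exp_nat_mul]
  rw [show ∀ a b c d e f : ℝ, a * b * (c * d) * (e * f) = a * c * e * (b * d * f) by
    intros; ring, ← Real.exp_add, ← Real.exp_add]
  congr 2
  simp [Complex.mul_im]
  ring

/-- The point `1/2 + √-15/6`. -/
noncomputable def cmTau : ℂ := ⟨1 / 2, Real.sqrt 15 / 6⟩

theorem cmTau_im_pos : 0 < cmTau.im := by
  change 0 < Real.sqrt 15 / 6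
  positivity

theorem norm_sq_cmTau : ‖cmTau‖ ^ 2 = 2 / 3 := by
  rw [Complex.sq_norm, Complex.normSq_apply]
  simp only [cmTau]
  linear_combination (Real.sq_sqrt (by norm_num : (0 : ℝ) ≤ 15)) / 36

theorem neg_inv_cmTau : -1 / cmTau = (3 * cmTau - 3) / 2 := by
  have h0 : cmTau ≠ 0 := fun h ↦ by simpa [h] using cmTau_im_pos
  have hc : cmTau * starRingEnd ℂ cmTau = 2 / 3 := by
    rw [Complex.mul_conj, ← Complex.sq_norm, norm_sq_cmTau]
    norm_num
  have ha : cmTau + starRingEnd ℂ cmTau = 1 := by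
    rw [Complex.add_conj, cmTau]
    norm_num
  rw [div_eq_iff h0]
  linear_combination 3 / 2 * hc - 3 / 2 * cmTau * ha

theorem neg_conj_cmTau : -(starRingEnd ℂ cmTau) = cmTau - 1 := by
  have ha : cmTau + starRingEnd ℂ cmTau = 1 := by
    rw [Complex.add_conj, cmTau]
    norm_num
  linear_combination -ha

theorem norm_eta_three_mul_cmTau_pow : ‖ModularForm.eta (3 * cmTau)‖ ^ 3 =
    ‖cmTau‖ * ‖ModularForm.eta cmTau‖ ^ 2 * ‖ModularForm.eta (6 * cmTau)‖ := by
  have him : 0 < (3 * cmTau / 2).im := by simpa using cmTau_im_pos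
  have h := norm_eta_duplication (z := 3 * cmTau) (by simpa using cmTau_im_pos)
  have h1 : ‖ModularForm.eta ((3 * cmTau + 1) / 2)‖ = ‖ModularForm.eta (-1 / cmTau)‖ := by
    rw [neg_inv_cmTau, show (3 * cmTau + 1) / 2 = (3 * cmTau - 3) / 2 + 1 + 1 by ring,
      norm_eta_add_one, norm_eta_add_one]
  have h2 : ‖ModularForm.eta (3 * cmTau / 2)‖ = ‖ModularForm.eta (-1 / cmTau)‖ := by
    rw [← norm_eta_neg_conj him, neg_inv_cmTau]
    congr 2
    simp only [map_div₀, map_mul, Complex.conj_ofNat]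
    linear_combination 3 / 2 * neg_conj_cmTau
  rw [← h, h1, h2, ← sq, norm_eta_inv cmTau_im_pos]
  ring_nf

theorem norm_eta_cmTau_pow : ‖cmTau‖ * ‖ModularForm.eta cmTau‖ ^ 3 =
    2 * ‖ModularForm.eta (3 * cmTau)‖ ^ 2 * ‖ModularForm.eta (2 * cmTau)‖ := by
  have him : 0 < (cmTau / 2).im := by simpa using cmTau_im_pos
  have h := norm_eta_duplication cmTau_im_pos
  have h1 : ‖ModularForm.eta ((cmTau + 1) / 2)‖ = ‖ModularForm.eta (cmTau / 2)‖ := by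
    rw [← norm_eta_neg_conj him, ← norm_eta_add_one (-_)]
    congr 2
    simp only [map_div₀, Complex.conj_ofNat]
    linear_combination - neg_conj_cmTau / 2
  have h2 : ‖ModularForm.eta (-1 / (cmTau / 2))‖ = ‖ModularForm.eta (3 * cmTau)‖ := by
    rw [show -1 / (cmTau / 2) = 2 * (-1 / cmTau) by ring, neg_inv_cmTau, ← norm_eta_add_one,
      ← norm_eta_add_one, ← norm_eta_add_one]
    ring_nf
  have h3 := norm_eta_inv him
  rw [h2, norm_div, Complex.norm_ofNat] at h3
  rw [← h, h1, h3]
  ring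

theorem norm_eta_cmTau_pos {k : ℝ} (hk : 0 < k) : 0 < ‖ModularForm.eta (k * cmTau)‖ := by
  refine norm_pos_iff.2 (ModularForm.eta_ne_zero ?_)
  change 0 < (k * cmTau).im
  rw [Complex.im_ofReal_mul]
  exact mul_pos hk cmTau_im_pos

theorem norm_eta_mul_cmTau : ‖ModularForm.eta (2 * cmTau)‖ * ‖ModularForm.eta (6 * cmTau)‖ =
    ‖ModularForm.eta cmTau‖ * ‖ModularForm.eta (3 * cmTau)‖ / 2 := by
  have ha := norm_eta_cmTau_pos one_pos
  have hc := norm_eta_cmTau_pos three_pos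
  have ht : 0 < ‖cmTau‖ := norm_pos_iff.2 fun h ↦ by simpa [h] using cmTau_im_pos
  have h1 := norm_eta_three_mul_cmTau_pow
  have h2 := norm_eta_cmTau_pow
  rw [Complex.ofReal_one, one_mul] at ha
  rw [Complex.ofReal_ofNat] at hc
  generalize ‖ModularForm.eta cmTau‖ = a at *
  generalize ‖ModularForm.eta (3 * cmTau)‖ = c at *
  generalize ‖ModularForm.eta (2 * cmTau)‖ = b at *
  generalize ‖ModularForm.eta (6 * cmTau)‖ = d at *
  generalize ‖cmTau‖ = t at *
  have hne : t * a ^ 2 * c ^ 2 ≠ 0 := by positivity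
  refine mul_left_cancel₀ hne ?_
  linear_combination -(c ^ 2 * b * h1) - c ^ 3 / 2 * h2

theorem omega15_sq : Real.sqrt 3 * Omega15 ^ 2 =
    (‖ModularForm.eta cmTau‖ * ‖ModularForm.eta (3 * cmTau)‖) ^ 2 := by
  have ha := norm_eta_cmTau_pos one_pos
  have hc := norm_eta_cmTau_pos three_pos
  rw [Complex.ofReal_one, one_mul] at ha
  rw [Complex.ofReal_ofNat] at hc
  have ht : 0 < ‖cmTau‖ := norm_pos_iff.2 fun h ↦ by simpa [h] using cmTau_im_pos
  have h15 : Real.sqrt 15 ^ 2 = 15 := Real.sq_sqrt (by norm_num)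
  have h := log_norm_eta_cmPoint
  have h1 : ‖ModularForm.eta cmPointOne‖ = ‖ModularForm.eta (3 * cmTau)‖ := by
    rw [← norm_eta_add_one]
    congr 2
    apply Complex.ext
    · simp [cmPointOne, cmTau]
      norm_num
    · simp [cmPointOne, cmTau]
      ring
  have h2 : ‖ModularForm.eta cmPointTwo‖ ^ 2 = ‖cmTau‖ * ‖ModularForm.eta cmTau‖ ^ 2 := by
    rw [← norm_eta_inv cmTau_im_pos, neg_inv_cmTau, ← norm_eta_add_one (_ / _)]
    congr 3
    apply Complex.ext
    · simp [cmPointTwo, cmTau]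
      norm_num
    · simp [cmPointTwo, cmTau]
      ring
  have hy : cmPointOne.im * cmPointTwo.im = 15 / 8 := by
    change Real.sqrt 15 / 2 * (Real.sqrt 15 / 4) = 15 / 8
    linear_combination h15 / 8
  have hlog2 := congr_arg Real.log h2
  rw [Real.log_mul ht.ne' (by positivity), Real.log_pow, Real.log_pow] at hlog2
  have hlogt := congr_arg Real.log norm_sq_cmTau
  rw [Real.log_pow, Real.log_div two_ne_zero three_ne_zero] at hlogt
  have hlog8 : Real.log 8 = 3 * Real.log 2 := by
    rw [show (8 : ℝ) = 2 ^ 3 by norm_num, Real.log_pow]; norm_num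
  have hlog30 : Real.log (30 * π) = Real.log 2 + Real.log 15 + Real.log π := by
    rw [Real.log_mul (by norm_num) Real.pi_ne_zero, show (30 : ℝ) = 2 * 15 by norm_num,
      Real.log_mul two_ne_zero (by norm_num)]
  rw [hy, h1, Real.log_div (by norm_num) (by norm_num), hlog8] at h
  have hG {a : ℝ} (ha : 0 < a) : Real.Gamma a ≠ 0 := (Real.Gamma_pos_of_pos ha).ne'
  have hlogG := Real.log_div
    (x := Real.Gamma (1/15) * Real.Gamma (2/15) * Real.Gamma (4/15) * Real.Gamma (8/15))
    (y := Real.Gamma (7/15) * Real.Gamma (11/15) * Real.Gamma (13/15) * Real.Gamma (14/15))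
    (by simp [hG]) (by simp [hG])
  iterate 6 rw [Real.log_mul (by simp [hG]) (by simp [hG])] at hlogG
  set G := Real.Gamma (1/15) * Real.Gamma (2/15) * Real.Gamma (4/15) * Real.Gamma (8/15) /
    (Real.Gamma (7/15) * Real.Gamma (11/15) * Real.Gamma (13/15) * Real.Gamma (14/15))
  have hG0 : 0 < G := by
    have hpos {a : ℝ} (ha : 0 < a) := Real.Gamma_pos_of_pos ha
    have h1 := hpos (a := 1 / 15) (by norm_num)
    have h2 := hpos (a := 2 / 15) (by norm_num)
    have h4 := hpos (a := 4 / 15) (by norm_num)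
    have h8 := hpos (a := 8 / 15) (by norm_num)
    have h7 := hpos (a := 7 / 15) (by norm_num)
    have h11 := hpos (a := 11 / 15) (by norm_num)
    have h13 := hpos (a := 13 / 15) (by norm_num)
    have h14 := hpos (a := 14 / 15) (by norm_num)
    positivity
  have hS : sumChi (fun a ↦ Real.log (Real.Gamma a)) = Real.log G := by
    rw [hlogG, sumChi]
    ring
  have hΩ : Omega15 = 1 / Real.sqrt (30 * π) * G ^ ((1 : ℝ) / 4) := rfl
  have hs30 : 0 < Real.sqrt (30 * π) := Real.sqrt_pos.2 (by positivity)
  have hG4 : 0 < G ^ ((1 : ℝ) / 4) := Real.rpow_pos_of_pos hG0 _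
  refine Real.log_injOn_pos (Set.mem_Ioi.2 (by rw [hΩ]; positivity))
    (Set.mem_Ioi.2 (by positivity)) ?_
  rw [hΩ, Real.log_mul (by positivity) (by positivity), Real.log_pow,
    Real.log_mul (by positivity) (by positivity), Real.log_rpow hG0, one_div (√_), Real.log_inv,
    Real.log_sqrt (by positivity), Real.log_sqrt (by positivity), hlog30, Real.log_pow,
    Real.log_mul ha.ne' hc.ne']
  rw [hS] at h
  push_cast at hlog2 hlogt ⊢
  linear_combination -h + hlog2 + hlogt / 2

/-- The value `-exp (-π √15 / 3)` of `exp (2πiz)` at `z = 1/2 + √-15/6`. -/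
noncomputable def cmNome : ℝ := -Real.exp (-π * Real.sqrt 15 / 3)

theorem exp_two_pi_mul_cmTau (k : ℕ) :
    Complex.exp (2 * π * Complex.I * (k * cmTau)) = (cmNome ^ k : ℝ) := by
  have h : 2 * π * Complex.I * cmTau = π * Complex.I + (-π * Real.sqrt 15 / 3 : ℝ) := by
    apply Complex.ext
    · simp [cmTau]
      ring
    · simp [cmTau]
      ring
  rw [show 2 * π * Complex.I * (k * cmTau) = k * (2 * π * Complex.I * cmTau) by ring,
    Complex.exp_nat_mul, h, Complex.exp_add, Complex.exp_pi_mul_I, cmNome]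
  push_cast
  ring

theorem abs_cmNome_lt_one : |cmNome| < 1 := by
  rw [cmNome, abs_neg, Real.abs_exp, Real.exp_lt_one_iff]
  have : 0 < π * Real.sqrt 15 / 3 := by positivity
  linarith [neg_div 3 (π * Real.sqrt 15), neg_mul π (Real.sqrt 15)]

theorem hasProd_one_sub_cmNome_pow {k : ℕ} (hk : k ≠ 0) :
    HasProd (fun n : ℕ ↦ 1 - cmNome ^ (k * (n + 1)))
      (Real.exp (π * Real.sqrt 15 / 72) ^ k * ‖ModularForm.eta (k * cmTau)‖) := by
  have hlt : ‖((cmNome ^ k : ℝ) : ℂ)‖ < 1 := by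
    rw [Complex.norm_real, norm_pow, Real.norm_eq_abs]
    exact pow_lt_one₀ (abs_nonneg _) abs_cmNome_lt_one hk
  have h := (ModularForm.multipliable_one_sub_pow hlt).hasProd.norm
  rw [norm_eta_eq, exp_two_pi_mul_cmTau, ← mul_assoc, ← Real.exp_nat_mul, ← Real.exp_add]
  have hz : k * (π * Real.sqrt 15 / 72) + -(π * (k * cmTau : ℂ).im / 12) = 0 := by
    rw [← Complex.ofReal_natCast, Complex.im_ofReal_mul, cmTau]
    ring
  rw [hz, Real.exp_zero, one_mul]
  refine h.congr_fun fun n ↦ ?_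
  rw [← Complex.ofReal_pow, ← Complex.ofReal_one, ← Complex.ofReal_sub, Complex.norm_real,
    ← pow_mul, Real.norm_of_nonneg]
  have := (abs_le.1 (abs_pow cmNome (k * (n + 1)) ▸
    pow_le_one₀ (abs_nonneg _) abs_cmNome_lt_one.le : |cmNome ^ (k * (n + 1))| ≤ 1)).2
  linarith

end Analysis

/-- CM evaluation at `τ = 1/2 + i√15/6`, i.e. `q₀ = −e^{−π√15/3}`: one has
`t₃(q₀) = 1/64` and `f₃(q₀) = 4√3 Ω₁₅²`. -/
theorem CM_point_evaluation :
    t3 (-Real.exp (-π * Real.sqrt 15 / 3)) = 1/64 ∧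
    f3 (-Real.exp (-π * Real.sqrt 15 / 3)) = 4 * Real.sqrt 3 * Omega15^2 := by
  have h1 := hasProd_one_sub_cmNome_pow one_ne_zero
  have h2 := hasProd_one_sub_cmNome_pow two_ne_zero
  have h3 := hasProd_one_sub_cmNome_pow three_ne_zero
  have h6 := hasProd_one_sub_cmNome_pow (k := 6) (by norm_num)
  have hpos (k : ℕ) (hk : k ≠ 0) : 0 < ‖ModularForm.eta (k * cmTau)‖ := by
    have := norm_eta_cmTau_pos (k := k) (by positivity)
    rwa [Complex.ofReal_natCast] at this
  have p1 := hpos 1 one_ne_zero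
  have p2 := hpos 2 two_ne_zero
  have p3 := hpos 3 three_ne_zero
  have p6 := hpos 6 (by norm_num)
  have hbd := norm_eta_mul_cmTau
  have hx : cmNome = -(Real.exp (π * Real.sqrt 15 / 72) ^ 24)⁻¹ := by
    rw [cmNome, ← Real.exp_nat_mul, ← Real.exp_neg]
    push_cast
    ring_nf
  have hE := Real.exp_pos (π * Real.sqrt 15 / 72)
  rw [← show cmNome = -Real.exp (-π * Real.sqrt 15 / 3) from rfl, t3, f3,
    mul_assoc 4, omega15_sq]
  simp only [Nat.cast_one, one_mul, Nat.cast_ofNat] at h1 h2 h3 h6 p1 p2 p3 p6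
  generalize Real.exp (π * Real.sqrt 15 / 72) = E at *
  generalize ‖ModularForm.eta cmTau‖ = a at *
  generalize ‖ModularForm.eta (3 * cmTau)‖ = c at *
  generalize ‖ModularForm.eta (2 * cmTau)‖ = b at *
  generalize ‖ModularForm.eta (6 * cmTau)‖ = d at *
  have h13 := h1.mul h3
  have h26 := h2.mul h6
  rw [((h26.pow 6).div₀ (h13.pow 6) (by positivity)).tprod_eq,
    ((h13.pow 4).div₀ (h26.pow 2) (by positivity)).tprod_eq, hx,
    show E ^ 2 * b * (E ^ 6 * d) = E ^ 8 * (a * c / 2) by rw [← hbd]; ring]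
  constructor
  · field_simp
    norm_num
  · field_simp
    norm_num
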